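/- Let 1 < p < 2 and β > 0 with βq ≤ 1, where q = p/(p−1), let f ∈ A^1_β(𝕋), and let k be a positive integer with k ≤ q/2. If C_α(k × Z(f)) = 0 for some α < (2/q)(1 − βq)k, then f is cyclic in A^p_β(𝕋). -/

import Mathlib

open MeasureTheory Real Set Filter Topology ENNReal

noncomputable section

instance : Fact (0 < 2 * Real.pi) := ⟨by positivity⟩

/-- The weighted sum `∑ ‖c n‖^p (1+|n|)^{pβ}` of a Fourier-coefficient sequence,
i.e. `‖c‖_{ℓ^p_β}^p`. -/
def wSum (p β : ℝ) (c : ℤ → ℂ) : ℝ :=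
  ∑' n : ℤ, ‖c n‖ ^ p * (1 + |(n : ℝ)|) ^ (p * β)

/-- Membership in `A^p_β(𝕋)` (equivalently `ℓ^p_β(ℤ)`), expressed via the
Fourier coefficient sequence `c`. -/
def MemA (p β : ℝ) (c : ℤ → ℂ) : Prop :=
  Summable fun n : ℤ => ‖c n‖ ^ p * (1 + |(n : ℝ)|) ^ (p * β)

/-- The `A^p_β(𝕋)` (i.e. `ℓ^p_β(ℤ)`) norm of a Fourier-coefficient sequence. -/
def normA (p β : ℝ) (c : ℤ → ℂ) : ℝ := (wSum p β c) ^ (1 / p)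

/-- The function on the circle `𝕋 = ℝ/2πℤ` whose Fourier coefficient sequence is `c`,
namely `t ↦ ∑_{n ∈ ℤ} c_n e^{int}`. -/
def fSum (c : ℤ → ℂ) (t : AddCircle (2 * Real.pi)) : ℂ :=
  ∑' n : ℤ, c n * fourier n t

/-- The zero set `Z(f)` of the function `f` with Fourier coefficients `c`. -/
def zeroSet (c : ℤ → ℂ) : Set (AddCircle (2 * Real.pi)) := {t | fSum c t = 0}

/-- Convolution of coefficient sequences: the Fourier coefficients of the product
of the corresponding functions/distributions. -/
def convSeq (a c : ℤ → ℂ) (n : ℤ) : ℂ := ∑' k : ℤ, a k * c (n - k)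

/-- Cyclicity of (the element with coefficients) `c` in `A^p_β(𝕋)`: there are
trigonometric polynomials `P` (finitely supported coefficient sequences `a`) with
`‖1 - P·f‖_{A^p_β}` arbitrarily small. -/
def IsCyclicA (p β : ℝ) (c : ℤ → ℂ) : Prop :=
  ∀ ε : ℝ, 0 < ε → ∃ a : ℤ → ℂ, (Function.support a).Finite ∧
    normA p β (fun n => (if n = 0 then 1 else 0) - convSeq a c n) < ε

/-- Fourier coefficient `μ̂(n) = ∫ e^{-int} dμ(t)` of a measure on `ℝ/2πℤ`. -/
def muHat (μ : Measure (AddCircle (2 * Real.pi))) (n : ℤ) : ℂ :=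
  ∫ t, fourier (-n) t ∂μ

/-- The `α`-energy `I_α(μ) = ∑_{n ≥ 1} |μ̂(n)|²/(1+n)^{1-α}` of `μ` is finite. -/
def HasFiniteEnergy (α : ℝ) (μ : Measure (AddCircle (2 * Real.pi))) : Prop :=
  Summable fun n : ℕ => ‖muHat μ (n + 1)‖ ^ 2 / (1 + ((n : ℝ) + 1)) ^ (1 - α)

/-- `C_α(E) = 0`: every probability measure supported on a compact subset of `E`
has infinite `α`-energy. -/
def CapacityZero (α : ℝ) (E : Set (AddCircle (2 * Real.pi))) : Prop :=
  ∀ μ : Measure (AddCircle (2 * Real.pi)), IsProbabilityMeasure μ →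
    (∃ K, K ⊆ E ∧ IsCompact K ∧ μ Kᶜ = 0) → ¬ HasFiniteEnergy α μ

/-- `C_α(E) > 0`: some probability measure supported on a compact subset of `E`
has finite `α`-energy. -/
def CapacityPos (α : ℝ) (E : Set (AddCircle (2 * Real.pi))) : Prop :=
  ∃ μ : Measure (AddCircle (2 * Real.pi)), IsProbabilityMeasure μ ∧
    (∃ K, K ⊆ E ∧ IsCompact K ∧ μ Kᶜ = 0) ∧ HasFiniteEnergy α μ

/-- The `k`-fold Minkowski sum `k × E = E + ⋯ + E`. -/
def kFold (k : ℕ) (E : Set (AddCircle (2 * Real.pi))) : Set (AddCircle (2 * Real.pi)) :=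
  {x | ∃ g : Fin k → AddCircle (2 * Real.pi), (∀ i, g i ∈ E) ∧ x = ∑ i, g i}

/-- Smoothness (`C^∞`) of a function on the circle, via its lift to `ℝ`. -/
def SmoothOnCircle (φ : AddCircle (2 * Real.pi) → ℂ) : Prop :=
  ContDiff ℝ (⊤ : ℕ∞) fun x : ℝ => φ (↑x)

/-- `supp S ⊆ E` for the distribution `S` with Fourier coefficients `s`:
`⟨S, φ⟩ = ∑ₙ Ŝ(n) φ̂(−n) = 0` for every `C^∞` function `φ` supported in `𝕋 ∖ E`. -/
def DistSuppIn (s : ℤ → ℂ) (E : Set (AddCircle (2 * Real.pi))) : Prop :=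
  ∀ φ : AddCircle (2 * Real.pi) → ℂ, SmoothOnCircle φ → tsupport φ ⊆ Eᶜ →
    ∑' n : ℤ, s n * fourierCoeff φ (-n) = 0

/-- the weight `1+|n|` -/
def wt (n : ℤ) : ℝ := 1 + |(n : ℝ)|

def MemW (γ : ℝ) (a : ℤ → ℂ) : Prop := Summable fun n : ℤ => ‖a n‖ * wt n ^ γ

def nW (γ : ℝ) (a : ℤ → ℂ) : ℝ := ∑' n : ℤ, ‖a n‖ * wt n ^ γ

lemma one_le_wt (n : ℤ) : 1 ≤ wt n := by unfold wt; linarith [abs_nonneg (n : ℝ)]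

lemma wt_pos (n : ℤ) : 0 < wt n := lt_of_lt_of_le one_pos (one_le_wt n)

lemma wt_rpow_pos (n : ℤ) (γ : ℝ) : 0 < wt n ^ γ := Real.rpow_pos_of_pos (wt_pos n) γ

lemma wt_le_mul (n k : ℤ) : wt n ≤ wt k * wt (n - k) := by
  unfold wt
  push_cast
  have h : |(n : ℝ)| ≤ |(k : ℝ)| + |(n : ℝ) - k| := by
    have := abs_add_le (k : ℝ) (n - k)
    simpa using this
  nlinarith [abs_nonneg (k : ℝ), abs_nonneg ((n : ℝ) - k)]

lemma wt_rpow_le_mul {γ : ℝ} (hγ : 0 ≤ γ) (n k : ℤ) : wt n ^ γ ≤ wt k ^ γ * wt (n - k) ^ γ := by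
  rw [← Real.mul_rpow (wt_pos k).le (wt_pos _).le]
  exact Real.rpow_le_rpow (wt_pos n).le (wt_le_mul n k) hγ

lemma MemW.of_bound {γ γ' : ℝ} {a b : ℤ → ℂ} (C : ℝ) (h : MemW γ a)
    (hb : ∀ n, ‖b n‖ * wt n ^ γ' ≤ C * (‖a n‖ * wt n ^ γ)) : MemW γ' b := by
  refine Summable.of_nonneg_of_le (fun n => ?_) hb (Summable.mul_left C h)
  exact mul_nonneg (norm_nonneg _) (wt_rpow_pos n _).le

lemma MemW.mono {γ γ' : ℝ} {a : ℤ → ℂ} (h : MemW γ a) (hg : γ' ≤ γ) : MemW γ' a := by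
  refine h.of_bound 1 (fun n => ?_)
  rw [one_mul]
  exact mul_le_mul_of_nonneg_left (Real.rpow_le_rpow_of_exponent_le (one_le_wt n) hg) (norm_nonneg _)

lemma MemW.summable_norm {γ : ℝ} {a : ℤ → ℂ} (h : MemW γ a) (hg : 0 ≤ γ) :
    Summable fun n => ‖a n‖ := by
  have := h.mono hg
  simpa [MemW] using this

lemma nW_nonneg (γ : ℝ) (a : ℤ → ℂ) : 0 ≤ nW γ a :=
  tsum_nonneg fun n => mul_nonneg (norm_nonneg _) (wt_rpow_pos n _).le

lemma MemW.add {γ : ℝ} {a b : ℤ → ℂ} (ha : MemW γ a) (hb : MemW γ b) :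
    MemW γ (fun n => a n + b n) := by
  refine Summable.of_nonneg_of_le (fun n => ?_) (fun n => ?_) (Summable.add ha hb)
  · exact mul_nonneg (norm_nonneg _) (wt_rpow_pos n _).le
  · rw [← add_mul]
    exact mul_le_mul_of_nonneg_right (norm_add_le _ _) (wt_rpow_pos n _).le

lemma MemW.sub {γ : ℝ} {a b : ℤ → ℂ} (ha : MemW γ a) (hb : MemW γ b) :
    MemW γ (fun n => a n - b n) := by
  refine Summable.of_nonneg_of_le (fun n => ?_) (fun n => ?_) (Summable.add ha hb)
  · exact mul_nonneg (norm_nonneg _) (wt_rpow_pos n _).le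
  · rw [← add_mul]
    exact mul_le_mul_of_nonneg_right (norm_sub_le _ _) (wt_rpow_pos n _).le

def convEquiv : ℤ × ℤ ≃ ℤ × ℤ where
  toFun z := (z.2, z.1 - z.2)
  invFun z := (z.1 + z.2, z.1)
  left_inv z := by ext <;> simp
  right_inv z := by ext <;> simp

lemma conv_aux {γ : ℝ} (hγ : 0 ≤ γ) {a b : ℤ → ℂ} (ha : MemW γ a) (hb : MemW γ b) :
    MemW γ (convSeq a b) ∧ nW γ (convSeq a b) ≤ nW γ a * nW γ b := by
  have hF : Summable fun z : ℤ × ℤ => (‖a z.1‖ * wt z.1 ^ γ) * (‖b z.2‖ * wt z.2 ^ γ) :=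
    Summable.mul_of_nonneg ha hb
      (fun n => mul_nonneg (norm_nonneg _) (wt_rpow_pos n _).le)
      (fun n => mul_nonneg (norm_nonneg _) (wt_rpow_pos n _).le)
  have hG := (convEquiv.summable_iff).mpr hF
  have hGt := convEquiv.tsum_eq (fun z : ℤ × ℤ => (‖a z.1‖ * wt z.1 ^ γ) * (‖b z.2‖ * wt z.2 ^ γ))
  have hab := Summable.tsum_mul_tsum ha hb hF
  have hfib := hG.prod
  have hle : ∀ n, ‖convSeq a b n‖ * wt n ^ γ ≤
      ∑' k, (‖a k‖ * wt k ^ γ) * (‖b (n - k)‖ * wt (n - k) ^ γ) := by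
    intro n
    have hs := hG.prod_factor n
    simp only [convEquiv, Function.comp, Equiv.coe_fn_mk] at hs
    have hk : ∀ k, ‖a k * b (n - k)‖ * wt n ^ γ ≤
        (‖a k‖ * wt k ^ γ) * (‖b (n - k)‖ * wt (n - k) ^ γ) := by
      intro k
      rw [norm_mul]
      calc _ ≤ ‖a k‖ * ‖b (n - k)‖ * (wt k ^ γ * wt (n - k) ^ γ) := by
            gcongr
            exact wt_rpow_le_mul hγ n k
        _ = _ := by ring
    have hs1 : Summable fun k => ‖a k * b (n - k)‖ * wt n ^ γ :=
      Summable.of_nonneg_of_le (fun k => mul_nonneg (norm_nonneg _) (wt_rpow_pos n _).le) hk hs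
    have hs2 : Summable fun k => ‖a k * b (n - k)‖ := by
      have := hs1.mul_right (wt n ^ γ)⁻¹
      simpa [mul_assoc, mul_inv_cancel₀ (wt_rpow_pos n γ).ne'] using this
    calc ‖convSeq a b n‖ * wt n ^ γ ≤ (∑' k, ‖a k * b (n - k)‖) * wt n ^ γ := by
          gcongr
          · exact (wt_rpow_pos n _).le
          · exact norm_tsum_le_tsum_norm hs2
      _ = ∑' k, ‖a k * b (n - k)‖ * wt n ^ γ := by rw [tsum_mul_right]
      _ ≤ _ := hs1.tsum_le_tsum hk hs
  have hm : MemW γ (convSeq a b) :=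
    Summable.of_nonneg_of_le (fun n => mul_nonneg (norm_nonneg _) (wt_rpow_pos n _).le) hle hfib
  refine ⟨hm, ?_⟩
  calc nW γ (convSeq a b) ≤ _ := Summable.tsum_le_tsum hle hm hfib
    _ = ∑' z : ℤ × ℤ, (‖a z.2‖ * wt z.2 ^ γ) * (‖b (z.1 - z.2)‖ * wt (z.1 - z.2) ^ γ) :=
        (hG.tsum_prod).symm
    _ = ∑' z : ℤ × ℤ, (‖a z.1‖ * wt z.1 ^ γ) * (‖b z.2‖ * wt z.2 ^ γ) := hGt
    _ = nW γ a * nW γ b := hab.symm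

lemma MemW.conv {γ : ℝ} (hγ : 0 ≤ γ) {a b : ℤ → ℂ} (ha : MemW γ a) (hb : MemW γ b) :
    MemW γ (convSeq a b) := (conv_aux hγ ha hb).1

lemma nW_conv_le {γ : ℝ} (hγ : 0 ≤ γ) {a b : ℤ → ℂ} (ha : MemW γ a) (hb : MemW γ b) :
    nW γ (convSeq a b) ≤ nW γ a * nW γ b := (conv_aux hγ ha hb).2

lemma norm_fourier_apply (n : ℤ) (x : AddCircle (2 * π)) : ‖fourier n x‖ = 1 := by
  rw [fourier_apply]; exact Circle.norm_coe _

lemma fourier_apply_add (n : ℤ) (x y : AddCircle (2 * π)) :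
    fourier n (x + y) = fourier n x * fourier n y := by
  simp only [fourier_apply, smul_add, AddCircle.toCircle_add, Circle.coe_mul]

lemma summable_fSum {a : ℤ → ℂ} (ha : Summable fun n => ‖a n‖) (x : AddCircle (2 * π)) :
    Summable fun n => a n * fourier n x := by
  refine Summable.of_norm ?_
  simpa [norm_fourier_apply, -fourier_apply] using ha

lemma fSum_conv {a b : ℤ → ℂ} (ha : Summable fun n => ‖a n‖) (hb : Summable fun n => ‖b n‖)
    (x : AddCircle (2 * π)) : fSum (convSeq a b) x = fSum a x * fSum b x := by
  have ha' : Summable fun n => ‖a n * fourier n x‖ := by simpa [norm_fourier_apply, -fourier_apply] using ha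
  have hb' : Summable fun n => ‖b n * fourier n x‖ := by simpa [norm_fourier_apply, -fourier_apply] using hb
  have hs := summable_mul_of_summable_norm ha' hb'
  have hG := (convEquiv.summable_iff).mpr hs
  have hGt := convEquiv.tsum_eq (fun z : ℤ × ℤ => (a z.1 * fourier z.1 x) * (b z.2 * fourier z.2 x))
  unfold fSum
  rw [tsum_mul_tsum_of_summable_norm ha' hb', ← hGt]
  have h3 := hG.tsum_prod
  simp only [Function.comp_def] at h3
  rw [h3]
  refine tsum_congr fun n => ?_
  unfold convSeq
  rw [← tsum_mul_right]
  refine tsum_congr fun k => ?_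
  simp only [convEquiv, Equiv.coe_fn_mk]
  have : fourier n x = fourier k x * fourier (n - k) x := by
    rw [← fourier_add]; congr 2; ring
  rw [this]; ring

lemma continuous_fSum {a : ℤ → ℂ} (ha : Summable fun n => ‖a n‖) : Continuous (fSum a) := by
  unfold fSum
  refine continuous_tsum (fun n => by fun_prop) ha (fun n x => ?_)
  simp [norm_fourier_apply, -fourier_apply]

lemma norm_fSum_le {a : ℤ → ℂ} (ha : Summable fun n => ‖a n‖) (x : AddCircle (2 * π)) :
    ‖fSum a x‖ ≤ ∑' n, ‖a n‖ := by
  unfold fSum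
  have ha' : Summable fun n => ‖a n * fourier n x‖ := by simpa [norm_fourier_apply, -fourier_apply] using ha
  refine (norm_tsum_le_tsum_norm ha').trans (le_of_eq ?_)
  simp [norm_fourier_apply, -fourier_apply]

lemma norm_fSum_le_nW {γ : ℝ} (hγ : 0 ≤ γ) {a : ℤ → ℂ} (ha : MemW γ a) (x : AddCircle (2 * π)) :
    ‖fSum a x‖ ≤ nW γ a := by
  refine (norm_fSum_le (ha.summable_norm hγ) x).trans ?_
  refine Summable.tsum_le_tsum (fun n => ?_) (ha.summable_norm hγ) ha
  exact le_mul_of_one_le_right (norm_nonneg _) (Real.one_le_rpow (one_le_wt n) hγ)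

lemma fourierCoeff_fSum {a : ℤ → ℂ} (ha : Summable fun n => ‖a n‖) (n : ℤ) :
    fourierCoeff (fSum a) n = a n := by
  have hInt : ∀ m : ℤ, Integrable (fun t : AddCircle (2 * π) => fourier (-n) t * (a m * fourier m t))
      AddCircle.haarAddCircle := fun m =>
    (Continuous.integrable_of_hasCompactSupport (by fun_prop) (HasCompactSupport.of_compactSpace _))
  have h := hasSum_integral_of_summable_integral_norm hInt (by
    simpa [norm_fourier_apply, -fourier_apply] using ha)
  have h1 : fourierCoeff (fSum a) n = ∫ t : AddCircle (2 * π),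
      ∑' m, fourier (-n) t * (a m * fourier m t) ∂AddCircle.haarAddCircle := by
    unfold fourierCoeff fSum
    simp_rw [tsum_mul_left, smul_eq_mul]
  rw [h1, ← h.tsum_eq, tsum_eq_single n]
  · have : ∀ t : AddCircle (2 * π), fourier (-n) t * (a n * fourier n t) = a n := by
      intro t
      have h0 : fourier (-n) t * fourier n t = 1 := by rw [← fourier_add]; simp
      linear_combination (a n) * h0
    simp only [this, integral_const, probReal_univ, one_smul]
  · intro m hm
    have h2 := congrFun (fourierCoeff_fourier (T := 2 * π) m) n
    simp only [Pi.single_apply, hm.symm, if_false] at h2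
    unfold fourierCoeff at h2
    have : ∀ t : AddCircle (2 * π), fourier (-n) t * (a m * fourier m t) =
      a m * (fourier (-n) t • fourier m t) := by intro t; rw [smul_eq_mul]; ring
    simp_rw [this]
    rw [integral_const_mul, h2, mul_zero]

lemma fSum_inj {a b : ℤ → ℂ} (ha : Summable fun n => ‖a n‖) (hb : Summable fun n => ‖b n‖)
    (h : ∀ x, fSum a x = fSum b x) : a = b := by
  have : fSum a = fSum b := funext h
  funext n
  rw [← fourierCoeff_fSum ha, this, fourierCoeff_fSum hb]

lemma fSum_add {a b : ℤ → ℂ} (ha : Summable fun n => ‖a n‖) (hb : Summable fun n => ‖b n‖)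
    (x : AddCircle (2 * π)) : fSum (fun n => a n + b n) x = fSum a x + fSum b x := by
  unfold fSum
  rw [← (summable_fSum ha x).tsum_add (summable_fSum hb x)]
  simp_rw [add_mul]

lemma fSum_sub {a b : ℤ → ℂ} (ha : Summable fun n => ‖a n‖) (hb : Summable fun n => ‖b n‖)
    (x : AddCircle (2 * π)) : fSum (fun n => a n - b n) x = fSum a x - fSum b x := by
  unfold fSum
  rw [← (summable_fSum ha x).tsum_sub (summable_fSum hb x)]
  simp_rw [sub_mul]

/-- Parseval for continuous functions. -/
lemma parseval {g : AddCircle (2 * π) → ℂ} (hg : Continuous g) :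
    HasSum (fun n => ‖fourierCoeff g n‖ ^ 2) (∫ t, ‖g t‖ ^ 2 ∂AddCircle.haarAddCircle) := by
  have hm : MemLp g 2 (AddCircle.haarAddCircle (T := 2 * π)) :=
    hg.memLp_of_hasCompactSupport (HasCompactSupport.of_compactSpace _)
  have h := hasSum_sq_fourierCoeff hm.toLp
  have hae := hm.coeFn_toLp
  have h1 : ∀ n, fourierCoeff (hm.toLp : AddCircle (2 * π) → ℂ) n = fourierCoeff g n := fun n =>
    congrFun (fourierCoeff_congr_ae hae) n
  simp_rw [h1] at h
  convert h using 1
  refine integral_congr_ae ?_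
  filter_upwards [hae] with t ht
  rw [ht]

lemma fourierCoeff_translate (g : AddCircle (2 * π) → ℂ) (h : AddCircle (2 * π)) (n : ℤ) :
    fourierCoeff (fun x => g (x + h)) n = fourier n h * fourierCoeff g n := by
  unfold fourierCoeff
  have := integral_add_right_eq_self (μ := AddCircle.haarAddCircle)
    (fun t : AddCircle (2 * π) => fourier (-n) (t - h) • g t) h
  simp only [add_sub_cancel_right] at this
  rw [this, ← integral_const_mul]
  congr 1
  funext t
  simp only [sub_eq_add_neg, fourier_apply_add, smul_eq_mul]
  have : fourier (-n) (-h) = fourier n h := by simp [fourier_apply]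
  rw [this]; ring

lemma fourierCoeff_sub' {f g : AddCircle (2 * π) → ℂ} (hf : Continuous f) (hg : Continuous g)
    (n : ℤ) : fourierCoeff (fun x => f x - g x) n = fourierCoeff f n - fourierCoeff g n := by
  unfold fourierCoeff
  rw [← integral_sub]
  · simp_rw [smul_sub]
  · exact (Continuous.integrable_of_hasCompactSupport (by fun_prop) (HasCompactSupport.of_compactSpace _))
  · exact (Continuous.integrable_of_hasCompactSupport (by fun_prop) (HasCompactSupport.of_compactSpace _))

lemma parseval_diff {g : AddCircle (2 * π) → ℂ} (hg : Continuous g) (h : AddCircle (2 * π)) :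
    HasSum (fun n => ‖fourier n h - 1‖ ^ 2 * ‖fourierCoeff g n‖ ^ 2)
      (∫ t, ‖g (t + h) - g t‖ ^ 2 ∂AddCircle.haarAddCircle) := by
  have h1 : Continuous fun x => g (x + h) := by fun_prop
  have := parseval (g := fun x => g (x + h) - g x) (h1.sub hg)
  convert this using 2 with n
  rw [fourierCoeff_sub' h1 hg, fourierCoeff_translate, ← mul_pow, ← norm_mul]
  congr 2; ring

lemma norm_fourier_sub_one (n : ℤ) (h : ℝ) :
    ‖fourier n (h : AddCircle (2 * π)) - 1‖ = 2 * |Real.sin (n * h / 2)| := by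
  rw [fourier_coe_apply]
  have : (2 * π * Complex.I * n * h / ((2 * π : ℝ) : ℂ) : ℂ) = Complex.I * ((n * h : ℝ) : ℂ) := by
    have : (π : ℂ) ≠ 0 := by exact_mod_cast Real.pi_ne_zero
    push_cast
    field_simp
  rw [this, Complex.norm_exp_I_mul_ofReal_sub_one, norm_mul]
  simp

lemma norm_fourier_sub_one_le_two (n : ℤ) (h : AddCircle (2 * π)) :
    ‖fourier n h - 1‖ ≤ 2 := by
  refine (norm_sub_le _ _).trans ?_
  rw [norm_fourier_apply]; norm_num

lemma norm_fourier_sub_one_le (n : ℤ) (h : ℝ) :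
    ‖fourier n (h : AddCircle (2 * π)) - 1‖ ≤ |(n : ℝ)| * |h| := by
  rw [norm_fourier_sub_one, ← abs_mul]
  have := Real.abs_sin_le_abs (x := n * h / 2)
  rw [abs_div, abs_of_pos (two_pos : (0 : ℝ) < 2)] at this
  linarith

lemma le_norm_fourier_sub_one (n : ℤ) (h : ℝ) (hh : |(n : ℝ)| * |h| ≤ 1) :
    |(n : ℝ)| * |h| / 2 ≤ ‖fourier n (h : AddCircle (2 * π)) - 1‖ := by
  rw [norm_fourier_sub_one]
  have hx : |(n : ℝ) * h / 2| = |(n : ℝ)| * |h| / 2 := by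
    rw [abs_div, abs_mul, abs_of_pos (two_pos : (0 : ℝ) < 2)]
  have hpi := Real.pi_gt_three
  have hpi4 := Real.pi_le_four
  have h0 : 0 ≤ |(n : ℝ)| * |h| := by positivity
  have := Real.mul_abs_le_abs_sin (x := (n : ℝ) * h / 2) (by rw [hx]; linarith)
  rw [hx] at this
  have h2 : (1 : ℝ) / 2 ≤ 2 / π := by rw [div_le_div_iff₀] <;> linarith
  nlinarith

lemma exists_rep (h : AddCircle (2 * π)) : ∃ y : ℝ, (y : AddCircle (2 * π)) = h ∧ |y| = ‖h‖ := by
  induction h using QuotientAddGroup.induction_on with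
  | H x =>
    refine ⟨x - round ((2 * π)⁻¹ * x) * (2 * π), ?_, ?_⟩
    · rw [AddCircle.coe_sub]
      have := AddCircle.coe_period (2 * π)
      rw [← zsmul_eq_mul, AddCircle.coe_zsmul, this, smul_zero, sub_zero]
    · exact (AddCircle.norm_eq (2 * π)).symm

lemma norm_coe_le (h : ℝ) : ‖(h : AddCircle (2 * π))‖ ≤ |h| :=
  QuotientAddGroup.norm_mk_le_norm

def LipC (L : ℝ) (g : AddCircle (2 * π) → ℂ) : Prop := ∀ x h, ‖g (x + h) - g x‖ ≤ L * ‖h‖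

lemma LipC.continuous {L : ℝ} {g : AddCircle (2 * π) → ℂ} (h : LipC L g) : Continuous g := by
  have hL : LipschitzWith (Real.toNNReal L) g := by
    refine LipschitzWith.of_dist_le_mul fun x y => ?_
    have := h y (x - y)
    rw [add_sub_cancel] at this
    rw [dist_eq_norm, dist_eq_norm]
    exact this.trans (mul_le_mul_of_nonneg_right (Real.le_coe_toNNReal L) (norm_nonneg _))
  exact hL.continuous

lemma lip_sum {g : AddCircle (2 * π) → ℂ} {M : ℝ} (hM : 0 < M)
    (hb : ∀ x, ‖g x‖ ≤ M) (hl : LipC M g) (F : Finset ℤ) :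
    ∑ n ∈ F, (‖fourierCoeff g n‖ * wt n) ^ 2 ≤ 10 * M ^ 2 := by
  have hg := hl.continuous
  obtain ⟨N, hN⟩ : ∃ N : ℕ, 0 < N ∧ ∀ n ∈ F, |(n : ℝ)| ≤ N := by
    refine ⟨∑ n ∈ F, n.natAbs + 1, by omega, fun n hn => ?_⟩
    have := Finset.single_le_sum (f := fun n : ℤ => n.natAbs) (fun i _ => Nat.zero_le _) hn
    have h2 : n.natAbs ≤ ∑ n ∈ F, n.natAbs + 1 := by omega
    have h3 : ((n.natAbs : ℕ) : ℝ) ≤ ((∑ n ∈ F, n.natAbs + 1 : ℕ) : ℝ) := by exact_mod_cast h2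
    rwa [Nat.cast_natAbs, Int.cast_abs] at h3
  have hN0 : (0 : ℝ) < N := by exact_mod_cast hN.1
  have h1 : ∑ n ∈ F, ‖fourierCoeff g n‖ ^ 2 ≤ M ^ 2 := by
    have hp := parseval hg
    refine (sum_le_hasSum F (fun n _ => by positivity) hp).trans ?_
    have : ∫ t, ‖g t‖ ^ 2 ∂(AddCircle.haarAddCircle (T := 2 * π)) ≤
        ∫ t, M ^ 2 ∂(AddCircle.haarAddCircle (T := 2 * π)) := by
      refine integral_mono ?_ (integrable_const _) fun t => ?_
      · exact (Continuous.integrable_of_hasCompactSupport (by fun_prop) (HasCompactSupport.of_compactSpace _))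
      · exact pow_le_pow_left₀ (norm_nonneg _) (hb t) 2
    simpa using this
  have h2 : ∑ n ∈ F, ‖fourierCoeff g n‖ ^ 2 * |(n : ℝ)| ^ 2 ≤ 4 * M ^ 2 := by
    have hp := parseval_diff hg (((1 : ℝ) / N : ℝ) : AddCircle (2 * π))
    have h3 := (sum_le_hasSum F (fun n _ => by positivity) hp)
    have : ∫ t, ‖g (t + (((1 : ℝ) / N : ℝ) : AddCircle (2 * π))) - g t‖ ^ 2
          ∂(AddCircle.haarAddCircle (T := 2 * π)) ≤
        ∫ t, (M * (1 / N)) ^ 2 ∂(AddCircle.haarAddCircle (T := 2 * π)) := by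
      refine integral_mono ?_ (integrable_const _) fun t => ?_
      · exact (Continuous.integrable_of_hasCompactSupport (by fun_prop) (HasCompactSupport.of_compactSpace _))
      · refine pow_le_pow_left₀ (norm_nonneg _) ((hl t _).trans ?_) 2
        gcongr
        refine (norm_coe_le _).trans (le_of_eq (abs_of_pos (by positivity)))
    have h4 := h3.trans this
    simp only [integral_const, probReal_univ, one_smul] at h4
    have h5 : ∀ n ∈ F, ‖fourierCoeff g n‖ ^ 2 * |(n : ℝ)| ^ 2 ≤ 4 * N ^ 2 *
        (‖fourier n (((1 : ℝ) / N : ℝ) : AddCircle (2 * π)) - 1‖ ^ 2 * ‖fourierCoeff g n‖ ^ 2) := by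
      intro n hn
      have hab : |(1 : ℝ) / N| = 1 / N := abs_of_pos (by positivity)
      have := le_norm_fourier_sub_one n (1 / N) (by
        rw [hab, mul_one_div, div_le_one hN0]; exact hN.2 n hn)
      rw [hab] at this
      have h6 : |(n : ℝ)| ≤ 2 * N * ‖fourier n (((1 : ℝ) / N : ℝ) : AddCircle (2 * π)) - 1‖ := by
        calc |(n : ℝ)| = 2 * N * (|(n : ℝ)| * (1 / N) / 2) := by field_simp
          _ ≤ _ := by gcongr
      have h7 := pow_le_pow_left₀ (abs_nonneg _) h6 2
      calc _ ≤ ‖fourierCoeff g n‖ ^ 2 * (2 * N * ‖fourier n (((1 : ℝ) / N : ℝ) : AddCircle (2 * π)) - 1‖) ^ 2 := by gcongr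
        _ = _ := by ring
    refine (Finset.sum_le_sum h5).trans ?_
    rw [← Finset.mul_sum]
    calc _ ≤ 4 * (N : ℝ) ^ 2 * (M * (1 / N)) ^ 2 := by gcongr
      _ = 4 * M ^ 2 := by field_simp
  have h8 : ∀ n ∈ F, (‖fourierCoeff g n‖ * wt n) ^ 2 ≤
      2 * ‖fourierCoeff g n‖ ^ 2 + 2 * (‖fourierCoeff g n‖ ^ 2 * |(n : ℝ)| ^ 2) := by
    intro n _
    unfold wt
    have : (1 + |(n : ℝ)|) ^ 2 ≤ 2 + 2 * |(n : ℝ)| ^ 2 := by nlinarith [sq_nonneg (1 - |(n : ℝ)|)]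
    rw [mul_pow]
    nlinarith [sq_nonneg ‖fourierCoeff g n‖]
  refine (Finset.sum_le_sum h8).trans ?_
  rw [Finset.sum_add_distrib, ← Finset.mul_sum, ← Finset.mul_sum]
  linarith

lemma summable_wt {s : ℝ} (hs : 1 < s) : Summable fun n : ℤ => wt n ^ (-s) := by
  have h := (Real.summable_one_div_int_add_rpow (1 / 2) s).mpr hs
  refine Summable.of_nonneg_of_le (fun n => (wt_rpow_pos n _).le) (fun n => ?_) h
  rw [Real.rpow_neg (wt_pos n).le, ← one_div]
  have h0 : (0 : ℝ) < |(n : ℝ) + 1 / 2| := by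
    rw [abs_pos]
    intro h
    have h1 : (2 * n + 1 : ℝ) = 0 := by linarith
    have h2 : (2 * n + 1 : ℤ) = 0 := by exact_mod_cast h1
    omega
  refine one_div_le_one_div_of_le (Real.rpow_pos_of_pos h0 _) ?_
  refine Real.rpow_le_rpow h0.le ?_ (by linarith)
  unfold wt
  refine (abs_add_le _ _).trans ?_
  rw [abs_of_pos (by norm_num : (0 : ℝ) < 1 / 2)]
  linarith

lemma lip_mem {γ : ℝ} (hγ : γ < 1 / 2) : ∃ C : ℝ, 0 ≤ C ∧
    ∀ (g : AddCircle (2 * π) → ℂ) (M : ℝ), 0 < M → (∀ x, ‖g x‖ ≤ M) → LipC M g →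
      MemW γ (fourierCoeff g) ∧ nW γ (fourierCoeff g) ≤ C * M := by
  have hY := summable_wt (s := 2 - 2 * γ) (by linarith)
  refine ⟨(10 + ∑' n : ℤ, wt n ^ (-(2 - 2 * γ))) / 2, ?_, fun g M hM hb hl => ?_⟩
  · have : 0 ≤ ∑' n : ℤ, wt n ^ (-(2 - 2 * γ)) := tsum_nonneg fun n => (wt_rpow_pos n _).le
    positivity
  have hF : ∀ F : Finset ℤ, ∑ n ∈ F, ‖fourierCoeff g n‖ * wt n ^ γ ≤
      (10 + ∑' n : ℤ, wt n ^ (-(2 - 2 * γ))) / 2 * M := by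
    intro F
    have ht : ∀ n ∈ F, ‖fourierCoeff g n‖ * wt n ^ γ ≤
        ((‖fourierCoeff g n‖ * wt n) ^ 2 * (1 / M) + M * wt n ^ (-(2 - 2 * γ))) / 2 := by
      intro n _
      have e1 : wt n ^ γ = wt n * wt n ^ (γ - 1) := by
        rw [Real.rpow_sub_one (wt_pos n).ne']
        field_simp [(wt_pos n).ne']
      have e2 : wt n ^ (-(2 - 2 * γ)) = (wt n ^ (γ - 1)) ^ 2 := by
        rw [← Real.rpow_natCast, ← Real.rpow_mul (wt_pos n).le]
        congr 1; push_cast; ring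
      rw [e1, e2]
      generalize wt n ^ (γ - 1) = y
      rw [← mul_assoc]
      generalize ‖fourierCoeff g n‖ * wt n = x
      have : 0 ≤ (x - M * y) ^ 2 * (1 / M) := by positivity
      have e3 : (x - M * y) ^ 2 * (1 / M) = x ^ 2 * (1 / M) + M * y ^ 2 - 2 * (x * y) := by
        field_simp; ring
      linarith
    refine (Finset.sum_le_sum ht).trans ?_
    rw [← Finset.sum_div, Finset.sum_add_distrib, ← Finset.sum_mul, ← Finset.mul_sum]
    have h1 := lip_sum hM hb hl F
    have h2 := hY.sum_le_tsum F (fun n _ => (wt_rpow_pos n _).le)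
    have h3 : (∑ n ∈ F, (‖fourierCoeff g n‖ * wt n) ^ 2) * (1 / M) ≤ 10 * M := by
      calc _ ≤ 10 * M ^ 2 * (1 / M) := by gcongr
        _ = 10 * M := by field_simp
    have h4 := mul_le_mul_of_nonneg_left h2 hM.le
    linarith
  have hnn : ∀ n, 0 ≤ ‖fourierCoeff g n‖ * wt n ^ γ := fun n =>
    mul_nonneg (norm_nonneg _) (wt_rpow_pos n _).le
  have hm : MemW γ (fourierCoeff g) := summable_of_sum_le hnn hF
  exact ⟨hm, hm.tsum_le_of_sum_le hF⟩

lemma fSum_fourierCoeff {g : AddCircle (2 * π) → ℂ} (hg : Continuous g)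
    (hs : Summable fun n => ‖fourierCoeff g n‖) (x : AddCircle (2 * π)) :
    fSum (fourierCoeff g) x = g x := by
  have := has_pointwise_sum_fourier_series_of_summable (f := ⟨g, hg⟩) (Summable.of_norm hs) x
  exact this.tsum_eq

lemma norm_fourier_sub_one_le' (n : ℤ) (h : AddCircle (2 * π)) :
    ‖fourier n h - 1‖ ≤ |(n : ℝ)| * ‖h‖ := by
  obtain ⟨y, rfl, hy⟩ := exists_rep h
  rw [← hy]
  exact norm_fourier_sub_one_le n y

lemma lip_fSum_finite {a : ℤ → ℂ} (F : Finset ℤ) (ha : ∀ n, n ∉ F → a n = 0) :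
    LipC (∑ n ∈ F, ‖a n‖ * |(n : ℝ)|) (fSum a) := by
  intro x h
  have e : ∀ x, fSum a x = ∑ n ∈ F, a n * fourier n x := by
    intro x
    unfold fSum
    exact tsum_eq_sum fun n hn => by rw [ha n hn, zero_mul]
  rw [e, e, ← Finset.sum_sub_distrib, Finset.sum_mul]
  refine (norm_sum_le _ _).trans (Finset.sum_le_sum fun n _ => ?_)
  rw [fourier_apply_add]
  have : a n * (fourier n x * fourier n h) - a n * fourier n x =
      a n * fourier n x * (fourier n h - 1) := by ring
  rw [this, norm_mul, norm_mul, norm_fourier_apply, mul_one, mul_assoc]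
  gcongr
  exact norm_fourier_sub_one_le' n h

def pairS (s a : ℤ → ℂ) : ℂ := ∑' n, s n * a n

lemma pair_summable {β C : ℝ} {s a : ℤ → ℂ} (hs : ∀ n, ‖s n‖ ≤ C * wt n ^ β)
    (ha : MemW β a) : Summable fun n => ‖s n * a n‖ := by
  refine Summable.of_nonneg_of_le (fun n => norm_nonneg _) (fun n => ?_) (Summable.mul_left C ha)
  rw [norm_mul]
  calc _ ≤ C * wt n ^ β * ‖a n‖ := by gcongr; exact hs n
    _ = _ := by ring

lemma pair_le {β C : ℝ} {s a : ℤ → ℂ} (hs : ∀ n, ‖s n‖ ≤ C * wt n ^ β)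
    (ha : MemW β a) : ‖pairS s a‖ ≤ C * nW β a := by
  refine (norm_tsum_le_tsum_norm (pair_summable hs ha)).trans ?_
  unfold nW
  rw [← tsum_mul_left]
  refine (pair_summable hs ha).tsum_le_tsum (fun n => ?_) (Summable.mul_left C ha)
  rw [norm_mul]
  calc _ ≤ C * wt n ^ β * ‖a n‖ := by gcongr; exact hs n
    _ = _ := by ring

lemma pair_add {β C : ℝ} {s a b : ℤ → ℂ} (hs : ∀ n, ‖s n‖ ≤ C * wt n ^ β)
    (ha : MemW β a) (hb : MemW β b) : pairS s (fun n => a n + b n) = pairS s a + pairS s b := by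
  unfold pairS
  rw [← (pair_summable hs ha).of_norm.tsum_add (pair_summable hs hb).of_norm]
  simp_rw [mul_add]

lemma pair_conv {β C : ℝ} (hβ : 0 ≤ β) {s c g : ℤ → ℂ} (hs : ∀ n, ‖s n‖ ≤ C * wt n ^ β)
    (hc : MemW β c) (hg : MemW β g) (hann : ∀ m, ∑' n, s n * c (n - m) = 0) :
    pairS s (convSeq g c) = 0 := by
  have hF : Summable fun z : ℤ × ℤ => (‖g z.1‖ * wt z.1 ^ β) * (‖c z.2‖ * wt z.2 ^ β) :=
    Summable.mul_of_nonneg hg hc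
      (fun n => mul_nonneg (norm_nonneg _) (wt_rpow_pos n _).le)
      (fun n => mul_nonneg (norm_nonneg _) (wt_rpow_pos n _).le)
  have hG := ((convEquiv.summable_iff).mpr hF).mul_left C
  have hC : 0 ≤ C := by
    have := (norm_nonneg _).trans (hs 0)
    exact nonneg_of_mul_nonneg_left this (wt_rpow_pos 0 β)
  have hsum : Summable (Function.uncurry fun n k : ℤ => s n * (g k * c (n - k))) := by
    refine Summable.of_norm (Summable.of_nonneg_of_le (fun z => norm_nonneg _) (fun z => ?_) hG)
    simp only [Function.uncurry, convEquiv, Function.comp, Equiv.coe_fn_mk, norm_mul]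
    calc _ ≤ C * wt z.1 ^ β * (‖g z.2‖ * ‖c (z.1 - z.2)‖) := by gcongr; exact hs _
      _ ≤ C * (wt z.2 ^ β * wt (z.1 - z.2) ^ β) * (‖g z.2‖ * ‖c (z.1 - z.2)‖) := by
          gcongr; exact wt_rpow_le_mul hβ _ _
      _ = _ := by ring
  unfold pairS convSeq
  simp_rw [← tsum_mul_left]
  rw [← hsum.tsum_comm]
  rw [← tsum_zero (β := ℤ)]
  refine tsum_congr fun k => ?_
  have : ∀ n, s n * (g k * c (n - k)) = g k * (s n * c (n - k)) := fun n => by ring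
  simp_rw [this]
  rw [tsum_mul_left, hann, mul_zero]

lemma exists_trunc {β : ℝ} {c : ℤ → ℂ} (hc : MemW β c) {ε : ℝ} (hε : 0 < ε) :
    ∃ F : Finset ℤ, MemW β (fun n => (if n ∈ F then c n else 0) - c n) ∧
      nW β (fun n => (if n ∈ F then c n else 0) - c n) < ε := by
  have h := hc.hasSum
  have h2 := (h.eventually (lt_mem_nhds (sub_lt_self _ hε))).exists
  obtain ⟨F, hF⟩ := h2
  refine ⟨F, ?_⟩
  have h3 : HasSum (fun n => ∑ m ∈ F, if n = m then ‖c n‖ * wt n ^ β else 0)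
      (∑ n ∈ F, ‖c n‖ * wt n ^ β) := by
    refine hasSum_sum fun m _ => ?_
    have := hasSum_ite_eq m (‖c m‖ * wt m ^ β)
    convert this using 2 with n
    split_ifs with h
    · rw [h]
    · rfl
  have h4 := h.sub h3
  have e : (fun n => ‖(if n ∈ F then c n else 0) - c n‖ * wt n ^ β) =
      fun n => ‖c n‖ * wt n ^ β - ∑ m ∈ F, if n = m then ‖c n‖ * wt n ^ β else 0 := by
    funext n
    rw [Finset.sum_ite_eq]
    split_ifs with h <;> simp
  have h5 : HasSum (fun n => ‖(if n ∈ F then c n else 0) - c n‖ * wt n ^ β) _ := e ▸ h4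
  refine ⟨h5.summable, ?_⟩
  unfold nW
  rw [h5.tsum_eq]
  linarith

def kap (δ : ℝ) (z : ℂ) : ℂ := (starRingEnd ℂ) z / ((max ‖z‖ δ : ℝ) : ℂ) ^ 2

lemma kap_norm {δ : ℝ} (hδ : 0 < δ) (z : ℂ) : ‖kap δ z‖ ≤ 1 / δ := by
  unfold kap
  have hA : 0 < max ‖z‖ δ := lt_max_of_lt_right hδ
  rw [norm_div, norm_pow, Complex.norm_real, Complex.norm_conj, Real.norm_of_nonneg hA.le,
    div_le_div_iff₀ (by positivity) hδ, one_mul, sq]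
  exact mul_le_mul (le_max_left _ _) (le_max_right _ _) hδ.le hA.le

lemma kap_mul {δ : ℝ} (hδ : 0 < δ) (z : ℂ) (hz : δ ≤ ‖z‖) : kap δ z * z = 1 := by
  unfold kap
  rw [max_eq_left hz, div_mul_eq_mul_div, mul_comm ((starRingEnd ℂ) z) z, Complex.mul_conj']
  have : (‖z‖ : ℂ) ≠ 0 := by
    have : 0 < ‖z‖ := hδ.trans_le hz
    exact_mod_cast this.ne'
  field_simp

lemma kap_lip {δ : ℝ} (hδ : 0 < δ) (z w : ℂ) : ‖kap δ z - kap δ w‖ ≤ 3 / δ ^ 2 * ‖z - w‖ := by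
  unfold kap
  have hA : 0 < max ‖z‖ δ := lt_max_of_lt_right hδ
  have hB : 0 < max ‖w‖ δ := lt_max_of_lt_right hδ
  have hAd : δ ≤ max ‖z‖ δ := le_max_right _ _
  have hBd : δ ≤ max ‖w‖ δ := le_max_right _ _
  have hwB : ‖w‖ ≤ max ‖w‖ δ := le_max_left _ _
  have hAB : |max ‖w‖ δ - max ‖z‖ δ| ≤ ‖z - w‖ := by
    refine (abs_max_sub_max_le_abs _ _ _).trans ?_
    rw [norm_sub_rev]
    exact abs_norm_sub_norm_le _ _
  generalize max ‖z‖ δ = A at *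
  generalize max ‖w‖ δ = B at *
  have hA' : (A : ℂ) ≠ 0 := by exact_mod_cast hA.ne'
  have hB' : (B : ℂ) ≠ 0 := by exact_mod_cast hB.ne'
  have e : (starRingEnd ℂ) z / (A : ℂ) ^ 2 - (starRingEnd ℂ) w / (B : ℂ) ^ 2 =
      (starRingEnd ℂ) (z - w) / (A : ℂ) ^ 2 +
      (starRingEnd ℂ) w * (((B - A : ℝ) : ℂ) * ((B + A : ℝ) : ℂ)) / ((A : ℂ) ^ 2 * (B : ℂ) ^ 2) := by
    rw [map_sub]
    push_cast
    field_simp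
    ring
  rw [e]
  refine (norm_add_le _ _).trans ?_
  simp only [norm_div, norm_mul, norm_pow, Complex.norm_real, Complex.norm_conj, Real.norm_eq_abs]
  rw [abs_of_pos hA, abs_of_pos hB, abs_of_pos (by positivity : 0 < B + A)]
  have t1 : ‖z - w‖ / A ^ 2 ≤ 1 / δ ^ 2 * ‖z - w‖ := by
    rw [div_eq_mul_one_div, mul_comm]
    gcongr
  have t2 : ‖w‖ * (|B - A| * (B + A)) / (A ^ 2 * B ^ 2) ≤ 2 / δ ^ 2 * ‖z - w‖ := by
    calc _ ≤ B * (‖z - w‖ * (B + A)) / (A ^ 2 * B ^ 2) := by gcongr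
      _ = (1 / (A * A) + 1 / (A * B)) * ‖z - w‖ := by field_simp
      _ ≤ (1 / (δ * δ) + 1 / (δ * δ)) * ‖z - w‖ := by gcongr
      _ = _ := by ring
  calc _ ≤ 1 / δ ^ 2 * ‖z - w‖ + 2 / δ ^ 2 * ‖z - w‖ := add_le_add t1 t2
    _ = _ := by ring

lemma lip_pow {B L : ℝ} (hB : 0 < B) {Q : AddCircle (2 * π) → ℂ}
    (hb : ∀ x, ‖Q x‖ ≤ B) (hl : LipC L Q) (J : ℕ) :
    LipC (J * (B ^ J * (L / B))) (fun x => Q x ^ J) := by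
  induction J with
  | zero => intro x h; simp
  | succ J ih =>
    intro x h
    have h1 := ih x h
    have h2 := hl x h
    have e : Q (x + h) ^ (J + 1) - Q x ^ (J + 1) =
      Q (x + h) ^ J * (Q (x + h) - Q x) + (Q (x + h) ^ J - Q x ^ J) * Q x := by ring
    simp only at h1 ⊢
    rw [e]
    refine (norm_add_le _ _).trans ?_
    rw [norm_mul, norm_mul, norm_pow]
    calc _ ≤ B ^ J * (L * ‖h‖) + (J * (B ^ J * (L / B)) * ‖h‖) * B := by
          have n1 := norm_nonneg (Q (x + h) ^ J - Q x ^ J)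
          have n2 := norm_nonneg (Q (x + h) - Q x)
          have p1 : ‖Q (x + h)‖ ^ J ≤ B ^ J := pow_le_pow_left₀ (norm_nonneg _) (hb _) J
          exact add_le_add (mul_le_mul p1 h2 n2 (by positivity))
            (mul_le_mul h1 (hb x) (norm_nonneg _) (n1.trans h1))
      _ = _ := by push_cast; field_simp; ring

def dpow (d : ℤ → ℂ) : ℕ → ℤ → ℂ
  | 0 => fun n => if n = 0 then 1 else 0
  | J + 1 => convSeq (dpow d J) d

lemma one_memW (γ : ℝ) : MemW γ (fun n : ℤ => if n = 0 then (1 : ℂ) else 0) ∧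
    nW γ (fun n : ℤ => if n = 0 then (1 : ℂ) else 0) = 1 := by
  have h : HasSum (fun n : ℤ => ‖(if n = 0 then (1 : ℂ) else 0)‖ * wt n ^ γ) 1 := by
    convert hasSum_ite_eq (0 : ℤ) (1 : ℝ) using 2 with n
    split_ifs with h
    · subst h; simp [wt]
    · simp
  exact ⟨h.summable, h.tsum_eq⟩

lemma fSum_one (x : AddCircle (2 * π)) : fSum (fun n : ℤ => if n = 0 then (1 : ℂ) else 0) x = 1 := by
  unfold fSum
  rw [tsum_eq_single 0]
  · simp
  · intro n hn; simp [hn]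

lemma dpow_mem {β : ℝ} (hβ : 0 ≤ β) {d : ℤ → ℂ} (hd : MemW β d) (J : ℕ) :
    MemW β (dpow d J) ∧ nW β (dpow d J) ≤ nW β d ^ J ∧
      ∀ x, fSum (dpow d J) x = fSum d x ^ J := by
  induction J with
  | zero =>
    refine ⟨(one_memW β).1, ?_, fun x => ?_⟩
    · rw [pow_zero]; exact (one_memW β).2.le
    · rw [pow_zero]; exact fSum_one x
  | succ J ih =>
    refine ⟨ih.1.conv hβ hd, ?_, fun x => ?_⟩
    · refine (nW_conv_le hβ ih.1 hd).trans ?_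
      rw [pow_succ]
      exact mul_le_mul_of_nonneg_right ih.2.1 (nW_nonneg _ _)
    · show fSum (convSeq (dpow d J) d) x = _
      rw [fSum_conv (ih.1.summable_norm hβ) (hd.summable_norm hβ), ih.2.2, pow_succ]

lemma wiener_step {β C : ℝ} (hβ : 0 ≤ β) (hβ2 : β < 1 / 2) {s c a : ℤ → ℂ}
    (hs : ∀ n, ‖s n‖ ≤ C * wt n ^ β) (hc : MemW β c)
    (hann : ∀ m, ∑' n, s n * c (n - m) = 0) (ha : MemW β a) {r : ℝ} (hr : 0 < r)
    (hvan : ∀ z ∈ zeroSet c, ∀ h, ‖h‖ < r → fSum a (z + h) = 0) : pairS s a = 0 := by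
  have hfc := continuous_fSum (hc.summable_norm hβ)
  -- lower bound
  obtain ⟨δ, hδ, hlow⟩ : ∃ δ : ℝ, 0 < δ ∧ ∀ x, fSum a x ≠ 0 → 2 * δ ≤ ‖fSum c x‖ := by
    let V : Set (AddCircle (2 * π)) := {x | ∀ z ∈ zeroSet c, r ≤ ‖x - z‖}
    have hV : IsCompact V := by
      refine IsClosed.isCompact ?_
      have : V = ⋂ z ∈ zeroSet c, {x | r ≤ ‖x - z‖} := by ext x; simp [V]
      rw [this]
      exact isClosed_biInter fun z _ => isClosed_le continuous_const (by fun_prop)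
    obtain ⟨δ', h1, h2⟩ := hV.exists_forall_le' (f := fun x => ‖fSum c x‖) (a := 0)
      (hfc.norm.continuousOn) (by
        intro x hx
        rw [norm_pos_iff]
        intro h0
        have := hx x h0
        simp at this
        linarith)
    refine ⟨δ' / 2, by positivity, fun x hx => ?_⟩
    have : x ∈ V := by
      intro z hz
      by_contra! hlt
      have := hvan z hz (x - z) hlt
      rw [add_sub_cancel] at this
      exact hx this
    have := h2 x this
    linarith
  obtain ⟨F, hd, hdn⟩ := exists_trunc hc (half_pos hδ)
  set cF : ℤ → ℂ := fun n => if n ∈ F then c n else 0 with hcF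
  set d : ℤ → ℂ := fun n => cF n - c n with hdd
  have hcFm : MemW β cF := by
    refine hc.of_bound 1 fun n => ?_
    rw [one_mul]
    refine mul_le_mul_of_nonneg_right ?_ (wt_rpow_pos n _).le
    simp only [hcF]
    split_ifs <;> simp
  have hDval : ∀ x, fSum d x = fSum cF x - fSum c x := fun x =>
    fSum_sub (hcFm.summable_norm hβ) (hc.summable_norm hβ) x
  have hflip : LipC _ (fSum cF) := lip_fSum_finite F (fun n hn => by simp [hcF, hn])
  set L0 : ℝ := ∑ n ∈ F, ‖cF n‖ * |(n : ℝ)| with hL0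
  have hL0n : 0 ≤ L0 := Finset.sum_nonneg fun n _ => by positivity
  let Q : AddCircle (2 * π) → ℂ := fun x => kap δ (fSum cF x)
  have hQb : ∀ x, ‖Q x‖ ≤ 1 / δ := fun x => kap_norm hδ _
  have hQl : LipC (3 / δ ^ 2 * L0) Q := by
    intro x h
    refine (kap_lip hδ _ _).trans ?_
    rw [mul_assoc]
    gcongr
    exact hflip x h
  have hQid : ∀ x, fSum a x * Q x * fSum cF x = fSum a x := by
    intro x
    by_cases h0 : fSum a x = 0
    · rw [h0]; ring
    · have h1 := hlow x h0
      have h2 := norm_fSum_le_nW hβ hd x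
      rw [hDval] at h2
      have h3 : ‖fSum c x‖ ≤ ‖fSum cF x‖ + ‖fSum cF x - fSum c x‖ := by
        have := norm_sub_le (fSum cF x) (fSum cF x - fSum c x)
        simpa using this
      rw [mul_assoc, kap_mul hδ _ (by linarith), mul_one]
  obtain ⟨C1, hC1, hemb⟩ := lip_mem hβ2
  set L : ℝ := 3 / δ ^ 2 * L0 with hL
  have hLn : 0 ≤ L := by positivity
  let M : ℕ → ℝ := fun J => (1 / δ) ^ J * (1 + J * (L / (1 / δ)))
  have hM : ∀ J, 0 < M J := fun J => by positivity
  have hQJ : ∀ J, MemW β (fourierCoeff fun x => Q x ^ J) ∧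
      nW β (fourierCoeff fun x => Q x ^ J) ≤ C1 * M J := by
    intro J
    refine hemb _ _ (hM J) (fun x => ?_) (fun x h => ?_)
    · rw [norm_pow]
      refine (pow_le_pow_left₀ (norm_nonneg _) (hQb x) J).trans ?_
      refine le_mul_of_one_le_right (by positivity) ?_
      have : 0 ≤ J * (L / (1 / δ)) := by positivity
      linarith
    · refine (lip_pow (by positivity) hQb hQl J x h).trans ?_
      refine mul_le_mul_of_nonneg_right ?_ (norm_nonneg _)
      have : (0 : ℝ) ≤ (1 / δ) ^ J := by positivity
      simp only [M]
      nlinarith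
  let b : ℕ → ℤ → ℂ := fun J => fourierCoeff fun x => Q x ^ J
  have hbf : ∀ J x, fSum (b J) x = Q x ^ J := fun J x =>
    fSum_fourierCoeff (hQl.continuous.pow J) ((hQJ J).1.summable_norm hβ) x
  have hdp := fun J => dpow_mem hβ hd J
  let u : ℕ → ℤ → ℂ := fun J => convSeq (convSeq a (b J)) (dpow d J)
  have hab : ∀ J, MemW β (convSeq a (b J)) := fun J => ha.conv hβ (hQJ J).1
  have hu : ∀ J, MemW β (u J) := fun J => (hab J).conv hβ (hdp J).1
  have huf : ∀ J x, fSum (u J) x = fSum a x * Q x ^ J * fSum d x ^ J := by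
    intro J x
    simp only [u]
    rw [fSum_conv ((hab J).summable_norm hβ) ((hdp J).1.summable_norm hβ),
      fSum_conv (ha.summable_norm hβ) ((hQJ J).1.summable_norm hβ), (hdp J).2.2, hbf]
  have hstep : ∀ J, pairS s (u J) = pairS s (u (J + 1)) := by
    intro J
    have hv : MemW β (convSeq (convSeq a (b (J + 1))) (dpow d J)) := (hab (J + 1)).conv hβ (hdp J).1
    have hvc := hv.conv hβ hc
    have e : u J = fun n => u (J + 1) n +
        convSeq (convSeq (convSeq a (b (J + 1))) (dpow d J)) c n := by
      refine fSum_inj ((hu J).summable_norm hβ) (((hu (J + 1)).add hvc).summable_norm hβ)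
        fun x => ?_
      rw [fSum_add ((hu (J + 1)).summable_norm hβ) (hvc.summable_norm hβ), huf, huf,
        fSum_conv (hv.summable_norm hβ) (hc.summable_norm hβ),
        fSum_conv ((hab (J + 1)).summable_norm hβ) ((hdp J).1.summable_norm hβ),
        fSum_conv (ha.summable_norm hβ) ((hQJ (J + 1)).1.summable_norm hβ), (hdp J).2.2, hbf]
      have h1 := hQid x
      have h2 := hDval x
      rw [pow_succ (fSum d x)]
      nth_rewrite 3 [h2]
      rw [pow_succ (Q x)]
      linear_combination (-(Q x ^ J * fSum d x ^ J)) * h1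
    rw [e, pair_add hs (hu (J + 1)) hvc, pair_conv hβ hs hc hv hann, add_zero]
  have hall : ∀ J, pairS s (u J) = pairS s a := by
    intro J
    induction J with
    | zero =>
      congr 1
      refine fSum_inj ((hu 0).summable_norm hβ) (ha.summable_norm hβ) fun x => ?_
      rw [huf]; simp
    | succ J ih => rw [← hstep, ih]
  have hC : 0 ≤ C := by
    have := (norm_nonneg _).trans (hs 0)
    exact nonneg_of_mul_nonneg_left this (wt_rpow_pos 0 β)
  have hbound : ∀ J : ℕ, ‖pairS s a‖ ≤
      (C * (nW β a * C1)) * ((1 / 2 : ℝ) ^ J + (L / (1 / δ)) * (J * (1 / 2 : ℝ) ^ J)) := by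
    intro J
    rw [← hall J]
    refine (pair_le hs (hu J)).trans ?_
    have h1 : nW β (u J) ≤ nW β a * (C1 * M J) * (δ / 2) ^ J := by
      refine (nW_conv_le hβ (hab J) (hdp J).1).trans ?_
      have n1 := nW_nonneg β a
      have n2 := nW_nonneg β (b J)
      have n3 := (hM J).le
      refine mul_le_mul ((nW_conv_le hβ ha (hQJ J).1).trans ?_) ?_ (nW_nonneg _ _) (by positivity)
      · exact mul_le_mul_of_nonneg_left (hQJ J).2 n1
      · exact (hdp J).2.1.trans (pow_le_pow_left₀ (nW_nonneg _ _) hdn.le J)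
    refine (mul_le_mul_of_nonneg_left h1 hC).trans (le_of_eq ?_)
    have : (1 / δ) ^ J * (δ / 2) ^ J = (1 / 2 : ℝ) ^ J := by
      rw [← mul_pow]; congr 1; field_simp
    simp only [M]
    rw [← this]; ring
  have hlim : Tendsto (fun J : ℕ => (C * (nW β a * C1)) * ((1 / 2 : ℝ) ^ J +
      (L / (1 / δ)) * (J * (1 / 2 : ℝ) ^ J))) atTop (𝓝 0) := by
    have t1 := tendsto_pow_atTop_nhds_zero_of_lt_one (r := (1 / 2 : ℝ)) (by norm_num) (by norm_num)
    have t2 := tendsto_self_mul_const_pow_of_lt_one (r := (1 / 2 : ℝ)) (by norm_num) (by norm_num)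
    have := (t1.add (t2.const_mul (L / (1 / δ)))).const_mul (C * (nW β a * C1))
    simpa using this
  have := ge_of_tendsto' hlim hbound
  exact norm_le_zero_iff.mp this

lemma kfold_step {β C : ℝ} (hβ : 0 ≤ β) (hβ2 : β < 1 / 2) {s c : ℤ → ℂ}
    (hs : ∀ n, ‖s n‖ ≤ C * wt n ^ β) (hc : MemW β c)
    (hann : ∀ m, ∑' n, s n * c (n - m) = 0) (j : ℕ) :
    ∀ (a : ℤ → ℂ), MemW (β * j) a → ∀ r : ℝ, 0 < r →
    (∀ z ∈ kFold j (zeroSet c), ∀ h, ‖h‖ < r → fSum a (z + h) = 0) →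
    pairS (fun n => s n ^ j) a = 0 := by
  induction j with
  | zero =>
    intro a ha r hr hvan
    have := hvan 0 ⟨Fin.elim0, fun i => i.elim0, by simp⟩ 0 (by simpa using hr)
    unfold fSum at this
    unfold pairS
    simpa using this
  | succ j ih =>
    intro a ha r hr hvan
    have hC : 0 ≤ C := by
      have := (norm_nonneg _).trans (hs 0)
      exact nonneg_of_mul_nonneg_left this (wt_rpow_pos 0 β)
    have hb : MemW β (fun n => s n ^ j * a n) := by
      refine ha.of_bound (C ^ j) fun n => ?_
      rw [norm_mul, norm_pow]
      have e : wt n ^ (β * ((j + 1 : ℕ) : ℝ)) = (wt n ^ β) ^ j * wt n ^ β := by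
        rw [← pow_succ, ← Real.rpow_natCast, ← Real.rpow_mul (wt_pos n).le]
      rw [e]
      have := wt_rpow_pos n β
      calc _ ≤ (C * wt n ^ β) ^ j * ‖a n‖ * wt n ^ β := by gcongr; exact hs n
        _ = _ := by rw [mul_pow]; ring
    have key := wiener_step hβ hβ2 hs hc hann hb (half_pos hr) (by
      intro z hz h hh
      have h1 := ih (fun n => a n * fourier n (z + h)) (by
        refine (ha.mono (γ' := β * j) ?_).of_bound 1 fun n => ?_
        · push_cast; nlinarith
        · rw [norm_mul, norm_fourier_apply]; simp) (r / 2) (half_pos hr) (by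
        rintro y ⟨g, hg, rfl⟩ h' hh'
        have h2 := hvan (z + ∑ i, g i) ⟨Fin.cons z g, by
            intro i
            refine Fin.cases ?_ (fun i => ?_) i
            · simpa using hz
            · simpa using hg i, by simp [Fin.sum_univ_succ]⟩ (h + h') (by
              refine (norm_add_le _ _).trans_lt ?_
              linarith)
        rw [← h2]
        unfold fSum
        refine tsum_congr fun n => ?_
        rw [mul_assoc, ← fourier_apply_add]
        congr 2
        abel)
      unfold pairS at h1
      unfold fSum
      rw [← h1]
      refine tsum_congr fun n => ?_
      ring)
    unfold pairS at key ⊢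
    rw [← key]
    refine tsum_congr fun n => ?_
    ring

/-- dyadic step -/
def hstep (j : ℕ) : ℝ := (1 / 2 : ℝ) ^ j

def om (η : ℝ) (n : ℤ) : ℝ≥0∞ := ∑' j : ℕ, ENNReal.ofReal (((2 : ℝ) ^ j) ^ η) *
  ENNReal.ofReal (‖fourier n ((hstep j : ℝ) : AddCircle (2 * π)) - 1‖ ^ 2)

lemma hstep_pos (j : ℕ) : 0 < hstep j := by unfold hstep; positivity

lemma om_lower {η : ℝ} (h0 : 0 < η) (h1 : η ≤ 1) (n : ℤ) :
    ENNReal.ofReal (wt n ^ η) ≤ 32 * (1 + om η n) := by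
  by_cases hn : n = 0
  · subst hn
    have : wt 0 ^ η = 1 := by simp [wt]
    rw [this, ENNReal.ofReal_one]
    calc (1 : ℝ≥0∞) ≤ 32 * 1 := by norm_num
      _ ≤ _ := by gcongr; exact le_self_add
  · set k := n.natAbs with hk
    have hk0 : k ≠ 0 := by omega
    have hkn : |(n : ℝ)| = k := by rw [hk, Nat.cast_natAbs, Int.cast_abs]
    have hk1 : (1 : ℝ) ≤ k := by exact_mod_cast Nat.one_le_iff_ne_zero.mpr hk0
    set l := Nat.log 2 k
    have hl1 : ((2 : ℝ) ^ l) ≤ k := by exact_mod_cast Nat.pow_log_le_self 2 hk0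
    have hl2 : (k : ℝ) < 2 ^ (l + 1) := by exact_mod_cast Nat.lt_pow_succ_log_self (by norm_num) k
    have hhp : hstep (l + 1) = 1 / 2 ^ (l + 1) := by unfold hstep; rw [one_div_pow]
    have habs : |hstep (l + 1)| = 1 / 2 ^ (l + 1) := by rw [abs_of_pos (hstep_pos _), hhp]
    have hlow := le_norm_fourier_sub_one n (hstep (l + 1)) (by
      rw [habs, hkn, mul_one_div, div_le_one (by positivity)]; exact hl2.le)
    have hq : (1 : ℝ) / 4 ≤ |(n : ℝ)| * |hstep (l + 1)| / 2 := by
      rw [habs, hkn, pow_succ]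
      rw [mul_one_div, div_div, div_le_div_iff₀ (by norm_num) (by positivity)]
      linarith
    have hterm : ENNReal.ofReal (((2 : ℝ) ^ (l + 1)) ^ η) *
        ENNReal.ofReal (‖fourier n ((hstep (l + 1) : ℝ) : AddCircle (2 * π)) - 1‖ ^ 2) ≤ om η n :=
      ENNReal.le_tsum (f := fun j : ℕ => ENNReal.ofReal (((2 : ℝ) ^ j) ^ η) *
        ENNReal.ofReal (‖fourier n ((hstep j : ℝ) : AddCircle (2 * π)) - 1‖ ^ 2)) (l + 1)
    have hw : wt n ^ η ≤ 32 * (((2 : ℝ) ^ (l + 1)) ^ η *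
        ‖fourier n ((hstep (l + 1) : ℝ) : AddCircle (2 * π)) - 1‖ ^ 2) := by
      have e1 : wt n ≤ 2 * 2 ^ (l + 1) := by unfold wt; rw [hkn]; linarith
      have e2 : wt n ^ η ≤ 2 * ((2 : ℝ) ^ (l + 1)) ^ η := by
        calc wt n ^ η ≤ (2 * 2 ^ (l + 1)) ^ η := Real.rpow_le_rpow (wt_pos n).le e1 h0.le
          _ = 2 ^ η * ((2 : ℝ) ^ (l + 1)) ^ η := Real.mul_rpow (by norm_num) (by positivity)
          _ ≤ 2 ^ (1 : ℝ) * ((2 : ℝ) ^ (l + 1)) ^ η := by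
              gcongr; norm_num
          _ = _ := by rw [Real.rpow_one]
      have e3 : (1 / 4 : ℝ) ^ 2 ≤ ‖fourier n ((hstep (l + 1) : ℝ) : AddCircle (2 * π)) - 1‖ ^ 2 :=
        pow_le_pow_left₀ (by norm_num) (hq.trans hlow) 2
      have e4 : 0 < ((2 : ℝ) ^ (l + 1)) ^ η := Real.rpow_pos_of_pos (by positivity) _
      nlinarith
    calc ENNReal.ofReal (wt n ^ η) ≤ ENNReal.ofReal (32 * (((2 : ℝ) ^ (l + 1)) ^ η *
        ‖fourier n ((hstep (l + 1) : ℝ) : AddCircle (2 * π)) - 1‖ ^ 2)) := ENNReal.ofReal_le_ofReal hw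
      _ = 32 * (ENNReal.ofReal (((2 : ℝ) ^ (l + 1)) ^ η) *
        ENNReal.ofReal (‖fourier n ((hstep (l + 1) : ℝ) : AddCircle (2 * π)) - 1‖ ^ 2)) := by
          rw [ENNReal.ofReal_mul (by norm_num), ENNReal.ofReal_mul (by positivity)]
          norm_num
      _ ≤ 32 * (1 + om η n) := by gcongr; exact hterm.trans le_add_self

lemma om_upper {η : ℝ} (h0 : 0 < η) (h1 : η ≤ 1) : ∃ C : ℝ, 0 < C ∧ ∀ n : ℤ,
    om η n ≤ ENNReal.ofReal (C * wt n ^ η) := by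
  set ρ : ℝ := (1 / 2 : ℝ) ^ η with hρ
  have hρ0 : 0 < ρ := by positivity
  have hρ1 : ρ < 1 := Real.rpow_lt_one (by norm_num) (by norm_num) h0
  have hsum : Summable fun i : ℤ => ρ ^ i.natAbs := by
    refine Summable.of_nat_of_neg ?_ ?_ <;> simpa using summable_geometric_of_lt_one hρ0.le hρ1
  refine ⟨4 * ∑' i : ℤ, ρ ^ i.natAbs, ?_, fun n => ?_⟩
  · have := hsum.tsum_pos (fun i => by positivity) 0 (by simp)
    positivity
  set k := 1 + n.natAbs with hk
  have hk0 : k ≠ 0 := by omega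
  have hkn : wt n = k := by rw [hk]; unfold wt; push_cast; rw [Nat.cast_natAbs, Int.cast_abs]
  set m := Nat.log 2 k
  have hl1 : ((2 : ℝ) ^ m) ≤ wt n := by rw [hkn]; exact_mod_cast Nat.pow_log_le_self 2 hk0
  have hl2 : wt n < 2 ^ (m + 1) := by
    rw [hkn]; exact_mod_cast Nat.lt_pow_succ_log_self (by norm_num) k
  have hterm : ∀ j : ℕ, ((2 : ℝ) ^ j) ^ η *
      ‖fourier n ((hstep j : ℝ) : AddCircle (2 * π)) - 1‖ ^ 2 ≤
      4 * wt n ^ η * ρ ^ ((j : ℤ) - m).natAbs := by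
    intro j
    have hpj : 0 < ((2 : ℝ) ^ j) ^ η := by positivity
    have hwp := wt_rpow_pos n η
    have hT : (2 : ℝ) ^ η * ρ = 1 := by
      rw [hρ, ← Real.mul_rpow (by norm_num) (by norm_num)]; norm_num
    have hT1 : (2 : ℝ) ^ η ≤ 2 := by
      calc (2 : ℝ) ^ η ≤ 2 ^ (1 : ℝ) := Real.rpow_le_rpow_of_exponent_le (by norm_num) h1
        _ = 2 := Real.rpow_one 2
    have hT0 : 0 < (2 : ℝ) ^ η := by positivity
    have hpw : ∀ i : ℕ, ((2 : ℝ) ^ i) ^ η = ((2 : ℝ) ^ η) ^ i := fun i => by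
      rw [← Real.rpow_natCast, ← Real.rpow_natCast, ← Real.rpow_mul (by norm_num),
        ← Real.rpow_mul (by norm_num), mul_comm]
    have hmw : ((2 : ℝ) ^ η) ^ m ≤ wt n ^ η := by
      rw [← hpw]; exact Real.rpow_le_rpow (by positivity) hl1 h0.le
    rcases le_or_gt j m with hj | hj
    · obtain ⟨i, hi⟩ := Nat.exists_eq_add_of_le hj
      have hab : ((j : ℤ) - m).natAbs = i := by omega
      rw [hab, hpw]
      have hX : ‖fourier n ((hstep j : ℝ) : AddCircle (2 * π)) - 1‖ ^ 2 ≤ 4 := by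
        have := pow_le_pow_left₀ (norm_nonneg _)
          (norm_fourier_sub_one_le_two n ((hstep j : ℝ) : AddCircle (2 * π))) 2
        norm_num at this ⊢
        exact this
      have e : ((2 : ℝ) ^ η) ^ j = ((2 : ℝ) ^ η) ^ m * ρ ^ i := by
        rw [hi, pow_add, mul_assoc, ← mul_pow, hT, one_pow, mul_one]
      calc ((2 : ℝ) ^ η) ^ j * ‖fourier n ((hstep j : ℝ) : AddCircle (2 * π)) - 1‖ ^ 2
          ≤ ((2 : ℝ) ^ η) ^ j * 4 := by gcongr
        _ = 4 * ((2 : ℝ) ^ η) ^ m * ρ ^ i := by rw [e]; ring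
        _ ≤ _ := by gcongr
    · obtain ⟨i, hi⟩ := Nat.exists_eq_add_of_le hj.le
      have hab : ((j : ℤ) - m).natAbs = i := by omega
      rw [hab, hpw]
      have hX1 : ‖fourier n ((hstep j : ℝ) : AddCircle (2 * π)) - 1‖ ≤ 2 * (1 / 2) ^ i := by
        refine (norm_fourier_sub_one_le n (hstep j)).trans ?_
        rw [abs_of_pos (hstep_pos j)]
        have hn : |(n : ℝ)| ≤ 2 ^ (m + 1) := by
          have : |(n : ℝ)| ≤ wt n := by unfold wt; linarith
          linarith
        calc |(n : ℝ)| * hstep j ≤ 2 ^ (m + 1) * hstep j := by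
              have := hstep_pos j
              gcongr
          _ = 2 * (2 * (1 / 2)) ^ m * (1 / 2) ^ i := by
              unfold hstep; rw [hi, pow_add, mul_pow, pow_succ]; ring
          _ = _ := by norm_num
      have hX : ‖fourier n ((hstep j : ℝ) : AddCircle (2 * π)) - 1‖ ^ 2 ≤ 4 * (1 / 4) ^ i := by
        refine (pow_le_pow_left₀ (norm_nonneg _) hX1 2).trans_eq ?_
        rw [mul_pow, ← pow_mul, mul_comm i 2, pow_mul]; norm_num
      have hr : ((2 : ℝ) ^ η) ^ i * (1 / 4) ^ i ≤ ρ ^ i := by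
        rw [← mul_pow]
        refine pow_le_pow_left₀ (by positivity) ?_ i
        have : ρ = ((2 : ℝ) ^ η)⁻¹ := by
          field_simp; linarith
        rw [this, le_inv_comm₀ (by positivity) hT0, one_div, mul_inv, inv_inv,
          inv_mul_eq_div, le_div_iff₀ hT0]
        nlinarith
      calc ((2 : ℝ) ^ η) ^ j * ‖fourier n ((hstep j : ℝ) : AddCircle (2 * π)) - 1‖ ^ 2
          ≤ ((2 : ℝ) ^ η) ^ j * (4 * (1 / 4) ^ i) := by gcongr
        _ = 4 * ((2 : ℝ) ^ η) ^ m * (((2 : ℝ) ^ η) ^ i * (1 / 4) ^ i) := by rw [hi, pow_add]; ring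
        _ ≤ _ := by gcongr
  calc om η n ≤ ∑' j : ℕ, ENNReal.ofReal (4 * wt n ^ η * ρ ^ ((j : ℤ) - m).natAbs) := by
        refine ENNReal.tsum_le_tsum fun j => ?_
        rw [← ENNReal.ofReal_mul (by positivity)]
        exact ENNReal.ofReal_le_ofReal (hterm j)
    _ ≤ ∑' i : ℤ, ENNReal.ofReal (4 * wt n ^ η * ρ ^ i.natAbs) := by
        refine ENNReal.tsum_comp_le_tsum_of_injective (f := fun j : ℕ => (j : ℤ) - m) ?_
          (fun i : ℤ => ENNReal.ofReal (4 * wt n ^ η * ρ ^ i.natAbs))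
        intro a b hab
        simpa using hab
    _ = ENNReal.ofReal (∑' i : ℤ, 4 * wt n ^ η * ρ ^ i.natAbs) := by
        rw [ENNReal.ofReal_tsum_of_nonneg _ (hsum.mul_left _)]
        intro i
        have := wt_rpow_pos n η
        positivity
    _ = _ := by rw [tsum_mul_left]; congr 1; ring

lemma energy_eq (η : ℝ) {g : AddCircle (2 * π) → ℂ} (hg : Continuous g) :
    ∑' n : ℤ, ENNReal.ofReal (‖fourierCoeff g n‖ ^ 2) * (1 + om η n) =
    ENNReal.ofReal (∫ t, ‖g t‖ ^ 2 ∂AddCircle.haarAddCircle) +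
    ∑' j : ℕ, ENNReal.ofReal (((2 : ℝ) ^ j) ^ η) * ENNReal.ofReal
      (∫ t, ‖g (t + ((hstep j : ℝ) : AddCircle (2 * π))) - g t‖ ^ 2 ∂AddCircle.haarAddCircle) := by
  simp_rw [mul_add, mul_one]
  rw [ENNReal.tsum_add]
  congr 1
  · have := parseval hg
    rw [← this.tsum_eq, ENNReal.ofReal_tsum_of_nonneg (fun n => by positivity) this.summable]
  · unfold om
    simp_rw [← ENNReal.tsum_mul_left]
    rw [ENNReal.tsum_comm]
    refine tsum_congr fun j => ?_
    have := parseval_diff hg ((hstep j : ℝ) : AddCircle (2 * π))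
    rw [← this.tsum_eq, ENNReal.ofReal_tsum_of_nonneg (fun n => by positivity) this.summable,
      ← ENNReal.tsum_mul_left]
    refine tsum_congr fun n => ?_
    rw [ENNReal.ofReal_mul (by positivity)]
    ring

lemma energy_contract (η : ℝ) {g ψ : AddCircle (2 * π) → ℂ} (hg : Continuous g)
    (hψ : Continuous ψ) (hb : ∀ x, ‖ψ x‖ ≤ 2 * ‖g x‖)
    (hl : ∀ x y, ‖ψ x - ψ y‖ ≤ 2 * ‖g x - g y‖) :
    ∑' n : ℤ, ENNReal.ofReal (‖fourierCoeff ψ n‖ ^ 2) * (1 + om η n) ≤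
    4 * ∑' n : ℤ, ENNReal.ofReal (‖fourierCoeff g n‖ ^ 2) * (1 + om η n) := by
  have key : ∀ f1 f2 : AddCircle (2 * π) → ℂ, Continuous f1 → Continuous f2 →
      (∀ x, ‖f1 x‖ ≤ 2 * ‖f2 x‖) →
      ENNReal.ofReal (∫ t, ‖f1 t‖ ^ 2 ∂AddCircle.haarAddCircle) ≤
      4 * ENNReal.ofReal (∫ t, ‖f2 t‖ ^ 2 ∂AddCircle.haarAddCircle) := by
    intro f1 f2 h1 h2 h
    have e4 : (4 : ℝ≥0∞) = ENNReal.ofReal 4 := by norm_num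
    rw [e4, ← ENNReal.ofReal_mul (by norm_num), ← integral_const_mul]
    refine ENNReal.ofReal_le_ofReal (integral_mono ?_ ?_ fun t => ?_)
    · exact (Continuous.integrable_of_hasCompactSupport (by fun_prop) (HasCompactSupport.of_compactSpace _))
    · exact (Continuous.integrable_of_hasCompactSupport (by fun_prop) (HasCompactSupport.of_compactSpace _))
    · have := pow_le_pow_left₀ (norm_nonneg _) (h t) 2
      rw [mul_pow] at this
      norm_num at this
      exact this
  rw [energy_eq η hg, energy_eq η hψ, mul_add, ← ENNReal.tsum_mul_left]
  refine add_le_add (key _ _ hψ hg hb) (ENNReal.tsum_le_tsum fun j => ?_)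
  rw [mul_left_comm]
  gcongr
  exact key (fun t => ψ (t + ((hstep j : ℝ) : AddCircle (2 * π))) - ψ t)
    (fun t => g (t + ((hstep j : ℝ) : AddCircle (2 * π))) - g t)
    (by fun_prop) (by fun_prop) (fun x => hl _ _)

/-- squared weighted norm of a trigonometric polynomial -/
def N2 (η : ℝ) (a : ℤ →₀ ℂ) : ℝ := ∑ n ∈ a.support, ‖a n‖ ^ 2 * wt n ^ η

lemma N2_nonneg (η : ℝ) (a : ℤ →₀ ℂ) : 0 ≤ N2 η a :=
  Finset.sum_nonneg fun n _ => mul_nonneg (by positivity) (wt_rpow_pos n _).le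

lemma finsupp_summable (a : ℤ →₀ ℂ) : Summable fun n => ‖a n‖ :=
  summable_of_ne_finset_zero (s := a.support) fun n hn => by
    simp at hn; simp [hn]

lemma energy_trunc {η : ℝ} (h0 : 0 < η) (h1 : η ≤ 1) : ∃ C : ℝ, 0 < C ∧
    ∀ (a : ℤ →₀ ℂ) (ψ : AddCircle (2 * π) → ℂ), Continuous ψ →
    (∀ x, ‖ψ x‖ ≤ 2 * ‖fSum a x‖) → (∀ x y, ‖ψ x - ψ y‖ ≤ 2 * ‖fSum a x - fSum a y‖) →
    Summable (fun n => ‖fourierCoeff ψ n‖ ^ 2 * wt n ^ η) ∧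
    ∑' n, ‖fourierCoeff ψ n‖ ^ 2 * wt n ^ η ≤ C * N2 η a := by
  obtain ⟨C, hC, hup⟩ := om_upper h0 h1
  refine ⟨128 * (1 + C), by positivity, fun a ψ hψ hb hl => ?_⟩
  have hc := energy_contract η (continuous_fSum (finsupp_summable a)) hψ hb hl
  have hnn : ∀ n, 0 ≤ ‖fourierCoeff ψ n‖ ^ 2 * wt n ^ η := fun n =>
    mul_nonneg (by positivity) (wt_rpow_pos n _).le
  have e1 : ∑' n : ℤ, ENNReal.ofReal (‖fourierCoeff ψ n‖ ^ 2 * wt n ^ η) ≤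
      32 * ∑' n : ℤ, ENNReal.ofReal (‖fourierCoeff ψ n‖ ^ 2) * (1 + om η n) := by
    rw [← ENNReal.tsum_mul_left]
    refine ENNReal.tsum_le_tsum fun n => ?_
    rw [ENNReal.ofReal_mul (by positivity), mul_left_comm]
    gcongr
    exact om_lower h0 h1 n
  have e2 : ∑' n : ℤ, ENNReal.ofReal (‖fourierCoeff (fSum a) n‖ ^ 2) * (1 + om η n) ≤
      ENNReal.ofReal ((1 + C) * N2 η a) := by
    rw [tsum_eq_sum (s := a.support)]
    · unfold N2
      rw [Finset.mul_sum, ENNReal.ofReal_sum_of_nonneg]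
      · refine Finset.sum_le_sum fun n _ => ?_
        rw [fourierCoeff_fSum (finsupp_summable a), mul_left_comm, ENNReal.ofReal_mul (by positivity)]
        gcongr
        calc 1 + om η n ≤ ENNReal.ofReal (wt n ^ η) + ENNReal.ofReal (C * wt n ^ η) := by
              gcongr
              · rw [← ENNReal.ofReal_one]
                exact ENNReal.ofReal_le_ofReal (Real.one_le_rpow (one_le_wt n) h0.le)
              · exact hup n
          _ = _ := by
              rw [← ENNReal.ofReal_add (wt_rpow_pos n _).le
                (mul_nonneg hC.le (wt_rpow_pos n _).le)]
              congr 1; ring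
      · intro n _
        have := wt_rpow_pos n η
        positivity
    · intro n hn
      rw [fourierCoeff_fSum (finsupp_summable a)]
      simp at hn
      simp [hn]
  have e3 : ∑' n : ℤ, ENNReal.ofReal (‖fourierCoeff ψ n‖ ^ 2 * wt n ^ η) ≤
      ENNReal.ofReal (128 * (1 + C) * N2 η a) := by
    refine e1.trans ?_
    calc _ ≤ 32 * (4 * ENNReal.ofReal ((1 + C) * N2 η a)) := by
          gcongr
          refine hc.trans ?_
          gcongr
      _ = _ := by
          rw [show 128 * (1 + C) * N2 η a = 128 * ((1 + C) * N2 η a) by ring,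
            ENNReal.ofReal_mul (p := 128) (by norm_num), ← mul_assoc]
          norm_num
  have hsum : Summable (fun n => ‖fourierCoeff ψ n‖ ^ 2 * wt n ^ η) := by
    refine summable_of_sum_le (c := 128 * (1 + C) * N2 η a) hnn fun F => ?_
    have := (ENNReal.sum_le_tsum F).trans e3
    rw [← ENNReal.ofReal_sum_of_nonneg (fun n _ => hnn n)] at this
    exact (ENNReal.ofReal_le_ofReal_iff
      (mul_nonneg (by positivity) (N2_nonneg _ _))).mp this
  refine ⟨hsum, ?_⟩
  rw [← ENNReal.ofReal_tsum_of_nonneg hnn hsum] at e3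
  exact (ENNReal.ofReal_le_ofReal_iff (mul_nonneg (by positivity) (N2_nonneg _ _))).mp e3

/-- truncation of twice the real part to `[0,1]` -/
def trc (z : ℂ) : ℝ := max 0 (min 1 (2 * z.re))

lemma trc_le (z : ℂ) : |trc z| ≤ 1 := by
  unfold trc
  rw [abs_of_nonneg (le_max_left _ _)]
  exact max_le (by norm_num) (min_le_left _ _)

lemma trc_lip (z w : ℂ) : |trc z - trc w| ≤ 2 * ‖z - w‖ := by
  unfold trc
  calc _ ≤ |min 1 (2 * z.re) - min 1 (2 * w.re)| := by
          simpa [max_comm] using (abs_max_sub_max_le_abs (min 1 (2 * z.re)) (min 1 (2 * w.re)) 0)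
    _ ≤ max |(1 : ℝ) - 1| |2 * z.re - 2 * w.re| := abs_min_sub_min_le_max _ _ _ _
    _ = 2 * |(z - w).re| := by
        rw [sub_self, abs_zero, max_eq_right (abs_nonneg _), ← mul_sub, abs_mul]; simp
    _ ≤ _ := by gcongr; exact Complex.abs_re_le_norm _

lemma trc_zero : trc 0 = 0 := by simp [trc]

lemma trc_one {z : ℂ} (h : 1 / 2 < z.re) : trc z = 1 := by
  unfold trc
  rw [min_eq_left (by linarith)]; norm_num

lemma low_bound {η γ : ℝ} (h0 : 0 < η) (h1 : η ≤ 1) (hγ0 : 0 ≤ γ) (hγ : γ < 1 / 2)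
    {K : Set (AddCircle (2 * π))} (hK : IsCompact K) {t : ℤ → ℂ}
    (ht : Summable fun n => ‖t n‖ ^ 2 * wt n ^ (-η)) (ht0 : t 0 ≠ 0)
    (hkill : ∀ a, MemW γ a → ∀ r, 0 < r →
      (∀ z ∈ K, ∀ h, ‖h‖ < r → fSum a (z + h) = 0) → pairS t a = 0) :
    ∃ c0 : ℝ, 0 < c0 ∧ ∀ a : ℤ →₀ ℂ, (∀ x ∈ K, 1 ≤ (fSum a x).re) → c0 ≤ √(N2 η a) := by
  obtain ⟨C, hC, hE⟩ := energy_trunc h0 h1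
  obtain ⟨C', _, hlm⟩ := lip_mem hγ
  set E := ∑' n, ‖t n‖ ^ 2 * wt n ^ (-η) with hEdef
  have hE0 : 0 ≤ E := tsum_nonneg fun n => mul_nonneg (by positivity) (wt_rpow_pos n _).le
  have hT : 0 < ‖t 0‖ := norm_pos_iff.mpr ht0
  refine ⟨‖t 0‖ / √(C * (E + 1)), by positivity, fun a ha => ?_⟩
  have hac : Continuous (fSum a) := continuous_fSum (finsupp_summable a)
  set ψ : AddCircle (2 * π) → ℂ := fun x => ((trc (fSum a x) : ℝ) : ℂ) with hψdef
  have hψl : ∀ x y, ‖ψ x - ψ y‖ ≤ 2 * ‖fSum a x - fSum a y‖ := by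
    intro x y
    simp only [hψdef]
    rw [← Complex.ofReal_sub, Complex.norm_real]
    exact trc_lip _ _
  have hψb : ∀ x, ‖ψ x‖ ≤ 2 * ‖fSum a x‖ := by
    intro x
    simp only [hψdef]
    rw [Complex.norm_real]
    have := trc_lip (fSum a x) 0
    simpa [trc_zero] using this
  have hLa := lip_fSum_finite (a := a) a.support (fun n hn => by simpa using hn)
  set L := ∑ n ∈ a.support, ‖a n‖ * |(n : ℝ)| with hL
  have hL0 : 0 ≤ L := Finset.sum_nonneg fun n _ => by positivity
  have hψL : LipC (2 * L + 2) ψ := by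
    intro x h
    refine (hψl _ _).trans ?_
    have := hLa x h
    nlinarith [norm_nonneg h]
  have hψc := hψL.continuous
  set G : AddCircle (2 * π) → ℂ := fun x => 1 - ψ x with hG
  have hGL : LipC (2 * L + 2) G := by
    intro x h
    have := hψL x h
    simp only [hG]
    rwa [show (1 : ℂ) - ψ (x + h) - (1 - ψ x) = -(ψ (x + h) - ψ x) by ring, norm_neg]
  have hψ1 : ∀ x, ‖ψ x‖ ≤ 1 := fun x => by
    simp only [hψdef]; rw [Complex.norm_real]; exact trc_le _
  have hGb : ∀ x, ‖G x‖ ≤ 2 * L + 2 := fun x => by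
    have := norm_sub_le (1 : ℂ) (ψ x)
    have h2 := hψ1 x
    simp only [hG]
    rw [norm_one] at this
    linarith
  have hGm := (hlm G (2 * L + 2) (by positivity) hGb hGL).1
  have hGs := hGm.summable_norm hγ0
  have hopen : IsOpen {x | 1 / 2 < (fSum a x).re} :=
    isOpen_lt continuous_const (Complex.continuous_re.comp hac)
  obtain ⟨r, hr, hsub⟩ := hK.exists_thickening_subset_open hopen (fun x hx => by
    have := ha x hx
    show 1 / 2 < (fSum a x).re
    linarith)
  have hz := hkill _ hGm r hr (fun z hz h hh => by
    rw [fSum_fourierCoeff hGL.continuous hGs]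
    have : z + h ∈ Metric.thickening r K := by
      rw [Metric.mem_thickening_iff]
      exact ⟨z, hz, by rw [dist_eq_norm, add_sub_cancel_left]; exact hh⟩
    have := hsub this
    simp only [hG, hψdef]
    rw [trc_one this]; simp)
  have hco : ∀ n, fourierCoeff G n = (if n = 0 then 1 else 0) - fourierCoeff ψ n := by
    intro n
    rw [hG, fourierCoeff_sub' continuous_const hψc]
    congr 1
    have hs : Summable fun n : ℤ => ‖(if n = 0 then (1 : ℂ) else 0)‖ :=
      (one_memW 0).1.summable_norm le_rfl
    have := fourierCoeff_fSum hs n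
    rw [← this]
    congr 1
    funext x
    exact (fSum_one x).symm
  obtain ⟨hS, hSle⟩ := hE a ψ hψc hψb hψl
  have hy : ∀ l : ℝ, 0 < l → ∀ n, ‖t n * fourierCoeff ψ n‖ ≤
      (l * (‖t n‖ ^ 2 * wt n ^ (-η)) + l⁻¹ * (‖fourierCoeff ψ n‖ ^ 2 * wt n ^ η)) / 2 := by
    intro l hl n
    rw [norm_mul]
    set w := wt n ^ (η / 2) with hw
    have hw0 : 0 < w := wt_rpow_pos n _
    have e1 : wt n ^ η = w ^ 2 := by
      rw [hw, ← Real.rpow_natCast, ← Real.rpow_mul (wt_pos n).le]; norm_num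
    have e2 : wt n ^ (-η) = (w ^ 2)⁻¹ := by rw [Real.rpow_neg (wt_pos n).le, e1]
    rw [e1, e2]
    set A := ‖t n‖; set B := ‖fourierCoeff ψ n‖
    have hm : l * (A ^ 2 * (w ^ 2)⁻¹) + l⁻¹ * (B ^ 2 * w ^ 2) - 2 * (A * B) =
      l⁻¹ * (l * A / w - B * w) ^ 2 := by field_simp; ring
    have : 0 ≤ l⁻¹ * (l * A / w - B * w) ^ 2 := by positivity
    linarith
  have hsumψ : Summable fun n => ‖t n * fourierCoeff ψ n‖ :=
    Summable.of_nonneg_of_le (fun n => norm_nonneg _) (hy 1 one_pos)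
      (((ht.mul_left 1).add (hS.mul_left 1⁻¹)).div_const 2)
  have hδ : HasSum (fun n : ℤ => t n * (if n = 0 then (1 : ℂ) else 0)) (t 0) := by
    convert hasSum_ite_eq (0 : ℤ) (t 0) using 2 with n
    split_ifs with h
    · subst h; simp
    · simp
  have hmain : t 0 = ∑' n, t n * fourierCoeff ψ n := by
    have := (hδ.sub hsumψ.of_norm.hasSum).tsum_eq
    unfold pairS at hz
    simp_rw [hco, mul_sub] at hz
    rw [hz] at this
    exact (sub_eq_zero.mp this.symm)
  set S := ∑' n, ‖fourierCoeff ψ n‖ ^ 2 * wt n ^ η with hSdef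
  have hbound : ∀ l : ℝ, 0 < l → ‖t 0‖ ≤ (l * E + l⁻¹ * S) / 2 := by
    intro l hl
    calc ‖t 0‖ ≤ ∑' n, ‖t n * fourierCoeff ψ n‖ := by
          rw [hmain]; exact norm_tsum_le_tsum_norm hsumψ
      _ ≤ ∑' n, (l * (‖t n‖ ^ 2 * wt n ^ (-η)) +
            l⁻¹ * (‖fourierCoeff ψ n‖ ^ 2 * wt n ^ η)) / 2 :=
          hsumψ.tsum_le_tsum (hy l hl) (((ht.mul_left l).add (hS.mul_left l⁻¹)).div_const 2)
      _ = _ := by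
          rw [tsum_div_const, (ht.mul_left l).tsum_add (hS.mul_left l⁻¹), tsum_mul_left,
            tsum_mul_left]
  have hb := hbound (‖t 0‖ / (E + 1)) (by positivity)
  have hsq : ‖t 0‖ ^ 2 ≤ S * (E + 1) := by
    have e1 : ‖t 0‖ / (E + 1) * E ≤ ‖t 0‖ := by
      rw [div_mul_eq_mul_div, div_le_iff₀ (by positivity)]; nlinarith
    have e2 : ‖t 0‖ ≤ (‖t 0‖ / (E + 1))⁻¹ * S := by linarith
    rw [inv_div, div_mul_eq_mul_div, le_div_iff₀ hT] at e2
    nlinarith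
  rw [div_le_iff₀ (by positivity), ← Real.sqrt_mul (N2_nonneg _ _)]
  refine Real.le_sqrt_of_sq_le ?_
  calc ‖t 0‖ ^ 2 ≤ S * (E + 1) := hsq
    _ ≤ (C * N2 η a) * (E + 1) := by gcongr
    _ = _ := by ring

lemma N2_eq (η : ℝ) {a : ℤ →₀ ℂ} {F : Finset ℤ} (h : a.support ⊆ F) :
    N2 η a = ∑ n ∈ F, ‖a n‖ ^ 2 * wt n ^ η :=
  Finset.sum_subset h fun n _ hn => by simp at hn; simp [hn]

lemma fSum_finsupp {a : ℤ →₀ ℂ} {F : Finset ℤ} (h : a.support ⊆ F) (x : AddCircle (2 * π)) :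
    fSum a x = ∑ n ∈ F, a n * fourier n x := by
  unfold fSum
  refine tsum_eq_sum fun n hn => ?_
  have : n ∉ a.support := fun h' => hn (h h')
  simp at this
  simp [this]

lemma fSum_finsupp_add (a b : ℤ →₀ ℂ) (x : AddCircle (2 * π)) :
    fSum (a + b : ℤ →₀ ℂ) x = fSum a x + fSum b x :=
  fSum_add (finsupp_summable a) (finsupp_summable b) x

lemma fSum_finsupp_smul (r : ℂ) (a : ℤ →₀ ℂ) (x : AddCircle (2 * π)) :
    fSum (r • a : ℤ →₀ ℂ) x = r * fSum a x := by
  unfold fSum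
  rw [← tsum_mul_left]
  refine tsum_congr fun n => ?_
  simp only [Finsupp.coe_smul, Pi.smul_apply, smul_eq_mul]
  ring

lemma SN_add (η : ℝ) (a b : ℤ →₀ ℂ) : √(N2 η (a + b)) ≤ √(N2 η a) + √(N2 η b) := by
  classical
  set F := a.support ∪ b.support
  rw [N2_eq η (F := F) Finsupp.support_add, N2_eq η (a := a) (F := F) Finset.subset_union_left,
    N2_eq η (a := b) (F := F) Finset.subset_union_right]
  have key := Real.Lp_add_le F (fun n => ‖a n‖ * wt n ^ (η / 2)) (fun n => ‖b n‖ * wt n ^ (η / 2))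
    (p := 2) (by norm_num)
  simp only [Real.rpow_two, sq_abs, ← Real.sqrt_eq_rpow] at key
  have e : ∀ n, wt n ^ η = (wt n ^ (η / 2)) ^ 2 := fun n => by
    rw [← Real.rpow_natCast, ← Real.rpow_mul (wt_pos n).le]; norm_num
  simp only [e, ← mul_pow]
  refine le_trans (Real.sqrt_le_sqrt (Finset.sum_le_sum fun n _ => ?_)) key
  have := (wt_rpow_pos n (η / 2)).le
  rw [← add_mul]
  gcongr
  exact norm_add_le _ _

lemma SN_smul (η : ℝ) {r : ℝ} (hr : 0 < r) (a : ℤ →₀ ℂ) :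
    √(N2 η ((r : ℂ) • a)) = r * √(N2 η a) := by
  rw [N2_eq η (F := a.support) Finsupp.support_smul]
  unfold N2
  have : ∑ n ∈ a.support, ‖((r : ℂ) • a) n‖ ^ 2 * wt n ^ η =
      r ^ 2 * ∑ n ∈ a.support, ‖a n‖ ^ 2 * wt n ^ η := by
    rw [Finset.mul_sum]
    refine Finset.sum_congr rfl fun n _ => ?_
    rw [Finsupp.coe_smul, Pi.smul_apply, norm_smul, Complex.norm_real, mul_pow, Real.norm_eq_abs,
      sq_abs]
    ring
  rw [this, Real.sqrt_mul (by positivity), Real.sqrt_sq hr.le]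

/-- The circle functional dominating on `K`. -/
def pK (η : ℝ) (K : Set (AddCircle (2 * π))) (g : AddCircle (2 * π) → ℝ) : ℝ :=
  sInf {y | ∃ a : ℤ →₀ ℂ, (∀ x ∈ K, g x ≤ (fSum a x).re) ∧ y = √(N2 η a)}

lemma pK_le (η : ℝ) {K : Set (AddCircle (2 * π))} {g : AddCircle (2 * π) → ℝ} {a : ℤ →₀ ℂ}
    (h : ∀ x ∈ K, g x ≤ (fSum a x).re) : pK η K g ≤ √(N2 η a) :=
  csInf_le ⟨0, fun y hy => by obtain ⟨a, _, rfl⟩ := hy; exact Real.sqrt_nonneg _⟩ ⟨a, h, rfl⟩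

lemma pK_nonneg (η : ℝ) (K : Set (AddCircle (2 * π))) (g : AddCircle (2 * π) → ℝ) :
    0 ≤ pK η K g :=
  Real.sInf_nonneg fun y hy => by obtain ⟨a, _, rfl⟩ := hy; exact Real.sqrt_nonneg _

lemma pK_ne (η : ℝ) {K : Set (AddCircle (2 * π))} {g : AddCircle (2 * π) → ℝ} {M : ℝ}
    (hM : ∀ x, g x ≤ M) :
    {y | ∃ a : ℤ →₀ ℂ, (∀ x ∈ K, g x ≤ (fSum a x).re) ∧ y = √(N2 η a)}.Nonempty := by
  refine ⟨_, Finsupp.single 0 (M : ℂ), fun x _ => ?_, rfl⟩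
  rw [fSum_finsupp (F := {0}) Finsupp.support_single_subset]
  simpa using hM x

lemma pK_exists (η : ℝ) {K : Set (AddCircle (2 * π))} {g : AddCircle (2 * π) → ℝ} {M : ℝ}
    (hM : ∀ x, g x ≤ M) {ε : ℝ} (hε : 0 < ε) :
    ∃ a : ℤ →₀ ℂ, (∀ x ∈ K, g x ≤ (fSum a x).re) ∧ √(N2 η a) < pK η K g + ε := by
  obtain ⟨y, ⟨a, h, rfl⟩, hy⟩ := exists_lt_of_csInf_lt (pK_ne η hM)
    (show pK η K g < pK η K g + ε by linarith)
  exact ⟨a, h, hy⟩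

lemma pK_add (η : ℝ) {K : Set (AddCircle (2 * π))} {g g' : AddCircle (2 * π) → ℝ} {M M' : ℝ}
    (hM : ∀ x, g x ≤ M) (hM' : ∀ x, g' x ≤ M') :
    pK η K (fun x => g x + g' x) ≤ pK η K g + pK η K g' := by
  refine le_of_forall_pos_le_add fun ε hε => ?_
  obtain ⟨a, ha, hae⟩ := pK_exists η (K := K) hM (half_pos hε)
  obtain ⟨b, hb, hbe⟩ := pK_exists η (K := K) hM' (half_pos hε)
  have := pK_le η (K := K) (g := fun x => g x + g' x) (a := a + b) (fun x hx => by
    rw [fSum_finsupp_add, Complex.add_re]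
    exact add_le_add (ha x hx) (hb x hx))
  have := SN_add η a b
  linarith

lemma pK_smul_le (η : ℝ) {K : Set (AddCircle (2 * π))} {g : AddCircle (2 * π) → ℝ} {M : ℝ}
    (hM : ∀ x, g x ≤ M) {r : ℝ} (hr : 0 < r) :
    pK η K (fun x => r * g x) ≤ r * pK η K g := by
  refine le_of_forall_pos_le_add fun ε hε => ?_
  obtain ⟨a, ha, hae⟩ := pK_exists η (K := K) hM (div_pos hε hr)
  have := pK_le η (K := K) (g := fun x => r * g x) (a := (r : ℂ) • a) (fun x hx => by
    rw [fSum_finsupp_smul, Complex.re_ofReal_mul]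
    exact mul_le_mul_of_nonneg_left (ha x hx) hr.le)
  rw [SN_smul η hr] at this
  have h2 := mul_lt_mul_of_pos_left hae hr
  rw [mul_add, mul_div_cancel₀ _ hr.ne'] at h2
  linarith

lemma pK_smul (η : ℝ) {K : Set (AddCircle (2 * π))} {g : AddCircle (2 * π) → ℝ} {M : ℝ}
    (hM : ∀ x, g x ≤ M) {r : ℝ} (hr : 0 < r) :
    pK η K (fun x => r * g x) = r * pK η K g := by
  refine le_antisymm (pK_smul_le η hM hr) ?_
  have := pK_smul_le η (K := K) (g := fun x => r * g x) (M := r * M)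
    (fun x => mul_le_mul_of_nonneg_left (hM x) hr.le) (inv_pos.mpr hr)
  have e : (fun x => r⁻¹ * (r * g x)) = g := by
    funext x; rw [inv_mul_cancel_left₀ hr.ne']
  rw [e] at this
  calc r * pK η K g ≤ r * (r⁻¹ * pK η K fun x => r * g x) := by gcongr
    _ = _ := by rw [mul_inv_cancel_left₀ hr.ne']

/-- continuous functions on the circle as compactly supported functions -/
def toCc (g : AddCircle (2 * π) → ℝ) (hg : Continuous g) :
    CompactlySupportedContinuousMap (AddCircle (2 * π)) ℝ :=
  ⟨⟨g, hg⟩, HasCompactSupport.of_compactSpace _⟩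

lemma cc_bdd (g : CompactlySupportedContinuousMap (AddCircle (2 * π)) ℝ) :
    ∃ M, ∀ x, g x ≤ M := by
  obtain ⟨M, hM⟩ := (isCompact_range g.continuous).bddAbove
  exact ⟨M, fun x => hM ⟨x, rfl⟩⟩

lemma exists_measure {η c0 : ℝ} (hc0 : 0 < c0) {K : Set (AddCircle (2 * π))} (hK : IsCompact K)
    (hlow : ∀ a : ℤ →₀ ℂ, (∀ x ∈ K, 1 ≤ (fSum a x).re) → c0 ≤ √(N2 η a)) :
    ∃ μ : Measure (AddCircle (2 * π)), IsFiniteMeasure μ ∧ μ ≠ 0 ∧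
      ∀ g : AddCircle (2 * π) → ℝ, Continuous g → ∀ a : ℤ →₀ ℂ,
        (∀ x ∈ K, g x ≤ (fSum a x).re) → ∫ x, g x ∂μ ≤ √(N2 η a) := by
  set one := toCc (fun _ => 1) continuous_const with hone
  have hone0 : one ≠ 0 := by
    intro h
    have : one 0 = 0 := by rw [h]; rfl
    have h1 : one 0 = 1 := rfl
    linarith
  set N : CompactlySupportedContinuousMap (AddCircle (2 * π)) ℝ → ℝ := fun g => pK η K g with hN
  have N_hom : ∀ r : ℝ, 0 < r → ∀ g, N (r • g) = r * N g := by
    intro r hr g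
    obtain ⟨M, hM⟩ := cc_bdd g
    exact pK_smul η hM hr
  have N_add : ∀ g g', N (g + g') ≤ N g + N g' := by
    intro g g'
    obtain ⟨M, hM⟩ := cc_bdd g
    obtain ⟨M', hM'⟩ := cc_bdd g'
    exact pK_add η hM hM'
  have hp1 : c0 ≤ N one := by
    refine le_csInf (pK_ne η (M := 1) fun x => le_rfl) ?_
    rintro y ⟨a, ha, rfl⟩
    exact hlow a ha
  obtain ⟨Λ, hΛ1, hΛ⟩ := exists_extension_of_le_sublinear
    (LinearPMap.mkSpanSingleton (σ := RingHom.id ℝ) one (N one) hone0) N N_hom N_add (by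
      rintro ⟨x, hx⟩
      obtain ⟨s, rfl⟩ := Submodule.mem_span_singleton.mp hx
      rw [LinearPMap.mkSpanSingleton'_apply]
      simp only [RingHom.id_apply, smul_eq_mul]
      rcases lt_or_ge 0 s with hs | hs
      · rw [N_hom s hs]
      · exact (mul_nonpos_of_nonpos_of_nonneg hs (hc0.le.trans hp1)).trans (pK_nonneg _ _ _))
  have hL1 : Λ one = N one := by
    have := hΛ1 ⟨one, Submodule.mem_span_singleton_self one⟩
    rw [LinearPMap.mkSpanSingleton_apply] at this
    exact this
  have hpos : ∀ g : CompactlySupportedContinuousMap (AddCircle (2 * π)) ℝ, 0 ≤ g → 0 ≤ Λ g := by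
    intro g hg
    have h1 := hΛ (-g)
    have h2 : N (-g) ≤ √(N2 η 0) := pK_le η (fun x _ => by
      have : 0 ≤ g x := hg x
      have e : fSum ((0 : ℤ →₀ ℂ)) x = 0 := by simp [fSum]
      rw [e]
      show - g x ≤ 0
      linarith)
    have h3 : √(N2 η 0) = 0 := by simp [N2]
    rw [map_neg] at h1
    linarith
  set P := PositiveLinearMap.mk₀ Λ hpos with hP
  have hInt : ∀ g, ∫ x, g x ∂(RealRMK.rieszMeasure P) = Λ g := fun g =>
    RealRMK.integral_rieszMeasure P g
  refine ⟨RealRMK.rieszMeasure P, inferInstance, ?_, ?_⟩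
  · intro h
    have := hInt one
    rw [h, integral_zero_measure, hL1] at this
    linarith
  · intro g hg a ha
    have := hInt (toCc g hg)
    have h2 : N (toCc g hg) ≤ √(N2 η a) := pK_le η ha
    have h3 := hΛ (toCc g hg)
    calc ∫ x, g x ∂(RealRMK.rieszMeasure P) = Λ (toCc g hg) := this
      _ ≤ _ := h3.trans h2

lemma exists_prob {α c0 : ℝ} (hc0 : 0 < c0) {K : Set (AddCircle (2 * π))} (hK : IsCompact K)
    (hlow : ∀ a : ℤ →₀ ℂ, (∀ x ∈ K, 1 ≤ (fSum a x).re) → c0 ≤ √(N2 (1 - α) a)) :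
    ∃ μ : Measure (AddCircle (2 * π)), IsProbabilityMeasure μ ∧ μ Kᶜ = 0 ∧
      HasFiniteEnergy α μ := by
  obtain ⟨μ, hfin, hμ0, hμ⟩ := exists_measure hc0 hK hlow
  have hN0 : √(N2 (1 - α) 0) = 0 := by simp [N2]
  have hKne : K.Nonempty := by
    by_contra h
    rw [Set.not_nonempty_iff_eq_empty] at h
    have := hlow 0 (by rw [h]; simp)
    linarith
  have hsupp : μ Kᶜ = 0 := by
    have hd : Continuous fun x : AddCircle (2 * π) => Metric.infDist x K :=
      Metric.continuous_infDist_pt K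
    have h1 := hμ _ hd 0 (fun x hx => by
      rw [Metric.infDist_zero_of_mem hx]; simp [fSum])
    rw [hN0] at h1
    have hi : Integrable (fun x : AddCircle (2 * π) => Metric.infDist x K) μ :=
      hd.integrable_of_hasCompactSupport (HasCompactSupport.of_compactSpace _)
    have h2 : ∫ x, Metric.infDist x K ∂μ = 0 :=
      le_antisymm h1 (integral_nonneg fun x => Metric.infDist_nonneg)
    rw [integral_eq_zero_iff_of_nonneg (fun x => Metric.infDist_nonneg) hi] at h2
    have h3 : ∀ᵐ x ∂μ, x ∈ K := by
      filter_upwards [h2] with x hx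
      exact (hK.isClosed.mem_iff_infDist_zero hKne).mpr hx
    exact h3
  set A : ℤ → ℂ := fun n => ∫ x, fourier n x ∂μ with hA
  have hfi : ∀ n : ℤ, Integrable (fun x : AddCircle (2 * π) => (fourier n x : ℂ)) μ := fun n =>
    (fourier n).continuous.integrable_of_hasCompactSupport (HasCompactSupport.of_compactSpace _)
  have hsumA : Summable fun n : ℤ => ‖A n‖ ^ 2 / wt n ^ (1 - α) := by
    refine summable_of_sum_le (c := 1)
      (fun n => div_nonneg (by positivity) (wt_rpow_pos n _).le) fun F => ?_
    classical
    set a : ℤ →₀ ℂ := ∑ n ∈ F, Finsupp.single n ((starRingEnd ℂ) (A n) / ((wt n ^ (1 - α) : ℝ) : ℂ)) with ha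
    have hav : ∀ n ∈ F, a n = (starRingEnd ℂ) (A n) / ((wt n ^ (1 - α) : ℝ) : ℂ) := by
      intro n hn
      rw [ha, Finsupp.finsetSum_apply, Finset.sum_eq_single n]
      · simp
      · intro m _ hm; simp [hm]
      · intro h; exact absurd hn h
    have has : a.support ⊆ F := by
      intro n hn
      by_contra h
      rw [Finsupp.mem_support_iff] at hn
      apply hn
      rw [ha, Finsupp.finsetSum_apply]
      refine Finset.sum_eq_zero fun m hm => ?_
      have : m ≠ n := fun e => h (e ▸ hm)
      simp [this]
    set X := ∑ n ∈ F, ‖A n‖ ^ 2 / wt n ^ (1 - α) with hX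
    have hNX : N2 (1 - α) a = X := by
      rw [N2_eq _ has, hX]
      refine Finset.sum_congr rfl fun n hn => ?_
      have hw := wt_rpow_pos n (1 - α)
      rw [hav n hn, norm_div, RCLike.norm_conj, Complex.norm_real, Real.norm_eq_abs, abs_of_pos hw]
      field_simp
    have hac : Continuous (fSum a) := continuous_fSum (finsupp_summable a)
    have h1 := hμ (fun x => (fSum a x).re) (Complex.continuous_re.comp hac) a (fun x _ => le_rfl)
    have h2 : ∫ x, (fSum a x).re ∂μ = X := by
      have hi : Integrable (fSum a) μ :=
        hac.integrable_of_hasCompactSupport (HasCompactSupport.of_compactSpace _)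
      have h3 : ∫ x, (fSum a x).re ∂μ = (∫ x, fSum a x ∂μ).re := integral_re hi
      rw [h3]
      simp_rw [fSum_finsupp has]
      rw [integral_finsetSum _ (fun n _ => (hfi n).const_mul _), Complex.re_sum, hX]
      refine Finset.sum_congr rfl fun n hn => ?_
      rw [integral_const_mul, hav n hn]
      show ((starRingEnd ℂ) (A n) / ((wt n ^ (1 - α) : ℝ) : ℂ) * A n).re = _
      rw [div_mul_eq_mul_div, mul_comm, Complex.mul_conj, ← Complex.ofReal_div, Complex.ofReal_re,
        Complex.normSq_eq_norm_sq]
    rw [h2, hNX] at h1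
    by_contra hlt
    push Not at hlt
    have h5 : √X * √X = X := Real.mul_self_sqrt (by linarith)
    have h6 : 1 < √X := by linarith
    nlinarith
  have hmass : μ univ ≠ 0 := by simpa using hμ0
  have hmass2 : μ univ ≠ ⊤ := measure_ne_top μ _
  refine ⟨(μ univ)⁻¹ • μ, ⟨?_⟩, ?_, ?_⟩
  · rw [Measure.smul_apply, smul_eq_mul, ENNReal.inv_mul_cancel hmass hmass2]
  · rw [Measure.smul_apply, hsupp, smul_zero]
  · unfold HasFiniteEnergy
    have hinj : Function.Injective fun n : ℕ => (-((n : ℤ) + 1) : ℤ) := by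
      intro a b h; simpa using h
    have := (hsumA.comp_injective hinj).mul_left (((μ univ)⁻¹).toReal ^ 2)
    refine this.congr fun n => ?_
    simp only [Function.comp]
    have e1 : muHat ((μ univ)⁻¹ • μ) (n + 1) = ((μ univ)⁻¹).toReal • A (-((n : ℤ) + 1)) := by
      unfold muHat
      rw [integral_smul_measure]
    have e2 : wt (-((n : ℤ) + 1)) = 1 + ((n : ℝ) + 1) := by
      unfold wt
      push_cast
      rw [abs_neg, abs_of_nonneg (by positivity)]
    rw [e1, e2, norm_smul, mul_pow, Real.norm_eq_abs, sq_abs, mul_div_assoc]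

lemma exists_annih {E : Type*} [NormedAddCommGroup E] [NormedSpace ℂ E] (V : Submodule ℂ E)
    {x : E} (hx : x ∉ closure (V : Set E)) :
    ∃ L : StrongDual ℂ E, (∀ v ∈ V, L v = 0) ∧ L x ≠ 0 := by
  let _ : NormedSpace ℝ E := NormedSpace.restrictScalars ℝ ℂ E
  have hcx : Convex ℝ (closure (V : Set E)) := by
    have : Convex ℝ (V : Set E) := (V.restrictScalars ℝ).convex
    exact this.closure
  obtain ⟨L, u, hu, hux⟩ := RCLike.geometric_hahn_banach_closed_point (𝕜 := ℂ) hcx isClosed_closure hx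
  have hV : ∀ v ∈ V, (L v).re < u := fun v hv => hu v (subset_closure hv)
  have hu0 : 0 < u := by simpa using hV 0 V.zero_mem
  refine ⟨L, fun v hv => ?_, fun h => ?_⟩
  · by_contra hne
    have hn : 0 < Complex.normSq (L v) := Complex.normSq_pos.mpr hne
    have := hV ((((u / Complex.normSq (L v) : ℝ) : ℂ) * (starRingEnd ℂ) (L v)) • v)
      (V.smul_mem _ hv)
    rw [map_smul, smul_eq_mul, mul_assoc, mul_comm ((starRingEnd ℂ) _), Complex.mul_conj,
      ← Complex.ofReal_mul, Complex.ofReal_re, div_mul_cancel₀ _ hn.ne'] at this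
    exact lt_irrefl _ this
  · rw [h] at hux
    simp at hux
    linarith

lemma shift_mem {β : ℝ} (hβ : 0 ≤ β) {c : ℤ → ℂ} (hc : MemW β c) (m : ℤ) :
    Summable fun n : ℤ => ‖((wt n ^ β : ℝ) : ℂ) * c (n - m)‖ := by
  have h1 : Summable fun n : ℤ => wt m ^ β * (‖c (n - m)‖ * wt (n - m) ^ β) :=
    ((Equiv.subRight m).summable_iff.mpr hc).mul_left _
  refine Summable.of_nonneg_of_le (fun n => norm_nonneg _) (fun n => ?_) h1
  have hw := wt_rpow_pos n β
  rw [norm_mul, Complex.norm_real, Real.norm_eq_abs, abs_of_pos hw]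
  calc wt n ^ β * ‖c (n - m)‖ ≤ wt m ^ β * wt (n - m) ^ β * ‖c (n - m)‖ := by
        gcongr; exact wt_rpow_le_mul hβ n m
    _ = _ := by ring

lemma duality {p q β : ℝ} (hp : 1 < p) (hq : q = p / (p - 1)) (hβ : 0 ≤ β) {c : ℤ → ℂ}
    (hc : MemW β c) (hnot : ¬ IsCyclicA p β c) :
    ∃ y : ℤ → ℂ, Summable (fun n => ‖y n‖ ^ q) ∧ y 0 ≠ 0 ∧
      ∀ m, ∑' n, (((wt n ^ β : ℝ) : ℂ) * y n) * c (n - m) = 0 := by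
  classical
  set P := ENNReal.ofReal p with hP
  have hPt : P.toReal = p := ENNReal.toReal_ofReal (by linarith)
  have hp0 : 0 < p := by linarith
  have hPt0 : 0 < P.toReal := by rw [hPt]; exact hp0
  have hP1 : (1 : ℝ≥0∞) ≤ P := by
    rw [hP, ← ENNReal.ofReal_one]; exact ENNReal.ofReal_le_ofReal hp.le
  have hPtop : P ≠ ⊤ := ENNReal.ofReal_ne_top
  have : Fact ((1 : ℝ≥0∞) ≤ P) := ⟨hP1⟩
  have hmem : ∀ m : ℤ, Memℓp (E := fun _ : ℤ => ℂ) (fun n : ℤ => ((wt n ^ β : ℝ) : ℂ) * c (n - m)) P := by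
    intro m
    refine Memℓp.of_exponent_ge (q := 1) (memℓp_gen ?_) hP1
    simpa using shift_mem hβ hc m
  set X : ℤ → lp (fun _ : ℤ => ℂ) P := fun m => ⟨_, hmem m⟩ with hX
  have hXv : ∀ m n, (X m : ∀ _ : ℤ, ℂ) n = ((wt n ^ β : ℝ) : ℂ) * c (n - m) := fun m n => rfl
  set δ : lp (fun _ : ℤ => ℂ) P := lp.single P 0 1 with hδ
  have hcl : δ ∉ closure (Submodule.span ℂ (Set.range X) : Set (lp (fun _ : ℤ => ℂ) P)) := by
    intro hin
    apply hnot
    intro ε hε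
    obtain ⟨v, hv, hd⟩ := Metric.mem_closure_iff.mp hin ε hε
    obtain ⟨a, rfl⟩ := Finsupp.mem_span_range_iff_exists_finsupp.mp hv
    refine ⟨a, ?_, ?_⟩
    · exact a.hasFiniteSupport
    · rw [dist_eq_norm, lp.norm_eq_tsum_rpow hPt0, hPt] at hd
      convert hd using 1
      unfold normA wSum
      congr 1
      refine tsum_congr fun n => ?_
      have hw := wt_rpow_pos n β
      have e1 : ((δ - a.sum fun i c => c • X i : lp (fun _ : ℤ => ℂ) P) : ∀ _ : ℤ, ℂ) n =
          ((wt n ^ β : ℝ) : ℂ) * ((if n = 0 then 1 else 0) - convSeq a c n) := by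
        rw [lp.coeFn_sub, Pi.sub_apply, mul_sub]
        congr 1
        · rw [hδ, lp.coeFn_single]
          by_cases hn : n = 0
          · subst hn; simp [wt]
          · simp [hn]
        · unfold convSeq
          rw [Finsupp.sum, lp.coeFn_sum, Finset.sum_apply, tsum_eq_sum (s := a.support), Finset.mul_sum]
          · refine Finset.sum_congr rfl fun m _ => ?_
            rw [lp.coeFn_smul, Pi.smul_apply, hXv, smul_eq_mul]
            ring
          · intro m hm
            simp at hm
            simp [hm]
      rw [e1, norm_mul, Complex.norm_real, Real.norm_eq_abs, abs_of_pos hw,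
        Real.mul_rpow hw.le (norm_nonneg _), ← Real.rpow_mul (wt_pos n).le, mul_comm β p, mul_comm]
      rfl
  obtain ⟨L, hL, hLδ⟩ := exists_annih _ hcl
  set y : ℤ → ℂ := fun n => L (lp.single P n 1) with hy
  have hsing : ∀ (n : ℤ) (z : ℂ), L (lp.single P n z) = z * y n := by
    intro n z
    have : (lp.single P n z : lp (fun _ : ℤ => ℂ) P) = z • lp.single P n 1 := by
      rw [← lp.single_smul]; simp
    rw [this, map_smul, smul_eq_mul]
  have hp10 : p - 1 ≠ 0 := by linarith
  have hq1 : 1 < q := by rw [hq, lt_div_iff₀ (by linarith)]; linarith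
  have hqp : (q - 1) * p = q := by rw [hq]; field_simp; ring
  refine ⟨y, ?_, hLδ, fun m => ?_⟩
  · refine summable_of_sum_le (c := ‖L‖ ^ q) (fun n => by positivity) fun F => ?_
    set S := ∑ n ∈ F, ‖y n‖ ^ q with hS
    have hS0 : 0 ≤ S := Finset.sum_nonneg fun n _ => by positivity
    rcases hS0.eq_or_lt with h0 | hSpos
    · rw [← h0]; positivity
    set f : ℤ → ℂ := fun n => (starRingEnd ℂ) (y n) * ((‖y n‖ ^ (q - 2) : ℝ) : ℂ) with hf
    have hfn : ∀ n, ‖f n‖ ^ p = ‖y n‖ ^ q := by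
      intro n
      by_cases h : y n = 0
      · simp only [hf, h]
        simp [Real.zero_rpow hp0.ne', Real.zero_rpow (show q ≠ 0 by linarith)]
      · have hpos : 0 < ‖y n‖ := norm_pos_iff.mpr h
        simp only [hf]
        rw [norm_mul, RCLike.norm_conj, Complex.norm_real, Real.norm_eq_abs,
          abs_of_pos (Real.rpow_pos_of_pos hpos _)]
        nth_rewrite 1 [← Real.rpow_one ‖y n‖]
        rw [← Real.rpow_add hpos, ← Real.rpow_mul hpos.le]
        congr 1
        linarith
    have hfy : ∀ n, f n * y n = ((‖y n‖ ^ q : ℝ) : ℂ) := by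
      intro n
      by_cases h : y n = 0
      · simp [hf, h, Real.zero_rpow (show q ≠ 0 by linarith)]
      · have hpos : 0 < ‖y n‖ := norm_pos_iff.mpr h
        simp only [hf]
        rw [mul_right_comm, mul_comm ((starRingEnd ℂ) _), Complex.mul_conj, ← Complex.ofReal_mul,
          Complex.normSq_eq_norm_sq, ← Real.rpow_natCast, ← Real.rpow_add hpos]
        congr 2
        push_cast; ring
    set x : lp (fun _ : ℤ => ℂ) P := ∑ n ∈ F, lp.single P n (f n) with hx
    have hxn : ‖x‖ ^ p = S := by
      have := lp.norm_sum_single hPt0 f F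
      rw [hPt] at this
      rw [hx, this, hS]
      exact Finset.sum_congr rfl fun n _ => hfn n
    have hLx : L x = (S : ℂ) := by
      rw [hx, map_sum, hS, Complex.ofReal_sum]
      refine Finset.sum_congr rfl fun n _ => ?_
      rw [hsing, hfy]
    have hle : S ≤ ‖L‖ * ‖x‖ := by
      have := L.le_opNorm x
      rw [hLx, Complex.norm_real, Real.norm_eq_abs, abs_of_pos hSpos] at this
      exact this
    have h1 : S ^ p ≤ ‖L‖ ^ p * S := by
      calc S ^ p ≤ (‖L‖ * ‖x‖) ^ p := Real.rpow_le_rpow hSpos.le hle hp0.le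
        _ = ‖L‖ ^ p * S := by rw [Real.mul_rpow (norm_nonneg _) (norm_nonneg _), hxn]
    have h2 : S ^ (p - 1) ≤ ‖L‖ ^ p := by
      rw [Real.rpow_sub_one hSpos.ne', div_le_iff₀ hSpos]; exact h1
    calc S = (S ^ (p - 1)) ^ (1 / (p - 1)) := by
          rw [← Real.rpow_mul hSpos.le, mul_one_div_cancel hp10, Real.rpow_one]
      _ ≤ (‖L‖ ^ p) ^ (1 / (p - 1)) :=
          Real.rpow_le_rpow (by positivity) h2 (by
            have : 0 < p - 1 := by linarith
            positivity)
      _ = ‖L‖ ^ q := by rw [← Real.rpow_mul (norm_nonneg _), hq]; congr 1; ring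
  · have h1 := L.hasSum (lp.hasSum_single hPtop (X m))
    rw [hL _ (Submodule.subset_span ⟨m, rfl⟩)] at h1
    rw [← h1.tsum_eq]
    refine tsum_congr fun n => ?_
    rw [hsing, hXv]; ring

lemma t_summable {q θ : ℝ} {k : ℕ} (hk : 0 < k) (hkq : (2 * k : ℝ) ≤ q) (hθ : 1 - 2 * k / q < θ)
    {y : ℤ → ℂ} (hy : Summable fun n => ‖y n‖ ^ q) :
    Summable fun n => ‖y n‖ ^ (2 * k) * wt n ^ (-θ) := by
  have hk0 : (0 : ℝ) < 2 * k := by positivity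
  have hq0 : 0 < q := by linarith
  rcases hkq.eq_or_lt with he | hlt
  · refine Summable.of_nonneg_of_le (fun n => mul_nonneg (by positivity) (wt_rpow_pos n _).le)
      (fun n => ?_) hy
    have e : ‖y n‖ ^ q = ‖y n‖ ^ (2 * k) := by
      rw [← he, ← Real.rpow_natCast]; push_cast; rfl
    rw [e]
    refine mul_le_of_le_one_right (by positivity) ?_
    refine Real.rpow_le_one_of_one_le_of_nonpos (one_le_wt n) ?_
    rw [he, div_self hq0.ne'] at hθ
    linarith
  · set u := 2 * k / q with hu
    have hu1 : u < 1 := by rw [hu, div_lt_one hq0]; exact hlt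
    have hu0 : 0 < u := by positivity
    have hpq : (u⁻¹).HolderConjugate ((1 - u)⁻¹) := by
      rw [Real.holderConjugate_iff]
      refine ⟨(one_lt_inv₀ hu0).mpr hu1, ?_⟩
      rw [inv_inv, inv_inv]; ring
    have h1u : 0 < 1 - u := by linarith
    have hs2 : Summable fun n : ℤ => wt n ^ (-(θ * (1 - u)⁻¹)) := summable_wt (by
      rw [← div_eq_mul_inv, lt_div_iff₀ h1u]; linarith)
    refine Summable.of_nonneg_of_le (fun n => mul_nonneg (by positivity) (wt_rpow_pos n _).le)
      (fun n => ?_) ((hy.div_const u⁻¹).add (hs2.div_const (1 - u)⁻¹))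
    have := Real.young_inequality_of_nonneg (a := ‖y n‖ ^ (2 * k)) (b := wt n ^ (-θ))
      (by positivity) (wt_rpow_pos n _).le hpq
    convert this using 3
    · rw [← Real.rpow_natCast, ← Real.rpow_mul (norm_nonneg _), hu]
      congr 1
      push_cast
      field_simp
    · rw [← Real.rpow_mul (wt_pos n).le]
      congr 1
      ring

lemma isCompact_kFold (k : ℕ) {E : Set (AddCircle (2 * π))} (hE : IsClosed E) :
    IsCompact (kFold k E) := by
  have h1 : IsCompact (Set.univ.pi fun _ : Fin k => E) := isCompact_univ_pi fun _ => hE.isCompact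
  have h2 := h1.image (f := fun g : Fin k → AddCircle (2 * π) => ∑ i, g i) (by fun_prop)
  convert h2 using 1
  ext x
  simp only [kFold, Set.mem_ofPred_eq, Set.mem_image, Set.mem_univ_pi]
  exact ⟨fun ⟨g, h, e⟩ => ⟨g, h, e.symm⟩, fun ⟨g, h, e⟩ => ⟨g, h, e.symm⟩⟩

/-- Theorem 3.2(a): let `1 < p < 2`, `β > 0`, `βq ≤ 1` where
`q = p/(p-1)`, `f ∈ A^1_β(𝕋)`, and let `k` be a positive integer with
`k ≤ q/2`. If `C_α(k × Z(f)) = 0` for some `α` with `0 ≤ α < (2/q)(1-βq)k`,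
then `f` is cyclic in `A^p_β(𝕋)`. -/
theorem stmt6 (p q β : ℝ) (hp1 : 1 < p) (hp2 : p < 2) (hβ : 0 < β)
    (hq : q = p / (p - 1)) (hβq : β * q ≤ 1)
    (c : ℤ → ℂ) (hc : MemA 1 β c)
    (k : ℕ) (hk : 0 < k) (hkq : (k : ℝ) ≤ q / 2)
    (α : ℝ) (hα0 : 0 ≤ α) (hα : α < (2 / q) * (1 - β * q) * (k : ℝ))
    (hcap : CapacityZero α (kFold k (zeroSet c))) :
    IsCyclicA p β c := by
  by_contra hnot
  have hcW : MemW β c := by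
    unfold MemA at hc
    unfold MemW
    simpa [wt] using hc
  have hk1 : (1 : ℝ) ≤ k := by exact_mod_cast hk
  have hq2 : 2 ≤ q := by linarith
  have hq0 : 0 < q := by linarith
  obtain ⟨y, hyq, hy0, hann⟩ := duality hp1 hq hβ.le hcW hnot
  -- numerology
  have hα' : α < 2 * k / q - 2 * k * β := by
    have : 2 / q * (1 - β * q) * k = 2 * k / q - 2 * k * β := by field_simp
    linarith
  have h2kq : 2 * k / q ≤ 1 := by rw [div_le_one hq0]; linarith
  have hkβ : β * k < 1 / 2 := by nlinarith
  have hβ2 : β < 1 / 2 := by nlinarith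
  have hα1 : α < 1 := by nlinarith
  -- pointwise bound
  set T := ∑' n, ‖y n‖ ^ q with hT
  have hyb : ∀ n, ‖y n‖ ≤ T ^ (1 / q) := by
    intro n
    have h1 : ‖y n‖ ^ q ≤ T := hyq.le_tsum n fun j _ => by positivity
    calc ‖y n‖ = (‖y n‖ ^ q) ^ (1 / q) := by
          rw [← Real.rpow_mul (norm_nonneg _), mul_one_div_cancel hq0.ne', Real.rpow_one]
      _ ≤ _ := Real.rpow_le_rpow (by positivity) h1 (by positivity)
  set s : ℤ → ℂ := fun n => ((wt n ^ β : ℝ) : ℂ) * y n with hs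
  have hsn : ∀ n, ‖s n‖ = wt n ^ β * ‖y n‖ := fun n => by
    simp only [hs]
    rw [norm_mul, Complex.norm_real, Real.norm_eq_abs, abs_of_pos (wt_rpow_pos n β)]
  have hsb : ∀ n, ‖s n‖ ≤ T ^ (1 / q) * wt n ^ β := fun n => by
    rw [hsn, mul_comm]
    exact mul_le_mul_of_nonneg_right (hyb n) (wt_rpow_pos n β).le
  have hclosed : IsClosed (zeroSet c) :=
    isClosed_eq (continuous_fSum (hcW.summable_norm hβ.le)) continuous_const
  have hKc := isCompact_kFold k hclosed
  have ht : Summable fun n => ‖s n ^ k‖ ^ 2 * wt n ^ (-(1 - α)) := by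
    have := t_summable (θ := 1 - α - 2 * k * β) hk (by linarith) (by linarith) hyq
    refine this.congr fun n => ?_
    rw [norm_pow, hsn, mul_pow, mul_pow, ← pow_mul, ← pow_mul, mul_comm k 2,
      ← Real.rpow_natCast (wt n ^ β), ← Real.rpow_mul (wt_pos n).le,
      mul_comm (wt n ^ (β * _)) (‖y n‖ ^ _), mul_assoc (‖y n‖ ^ _), ← Real.rpow_add (wt_pos n)]
    congr 2
    push_cast
    ring
  have ht0 : s 0 ^ k ≠ 0 := by
    refine pow_ne_zero _ (mul_ne_zero ?_ hy0)
    exact_mod_cast (wt_rpow_pos 0 β).ne'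
  obtain ⟨c0, hc0, hlow⟩ := low_bound (η := 1 - α) (γ := β * k) (by linarith) (by linarith)
    (by positivity) hkβ hKc (t := fun n => s n ^ k) ht ht0
    (fun a ha r hr h => kfold_step hβ.le hβ2 hsb hcW hann k a ha r hr h)
  obtain ⟨μ, hμp, hμK, hμe⟩ := exists_prob hc0 hKc hlow
  exact hcap μ hμp ⟨_, Subset.rfl, hKc, hμK⟩ hμe

end
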